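/- arXiv:2312.07259 — 12 statements merged into one kernel-verified Lean document; each statement's English description precedes it below -/
import Mathlib

section
/- For every integer i ≥ 1 define the pair (p_i, m_i) of integers by the recursion (p_1, m_1) = (0, 1), p_{i+1} = m_i − p_i, m_{i+1} = 5 m_i − 6 p_i + 1. Then a pair (p, m) of integers with p ≥ 0, m ≥ 1 and 2p ≤ m satisfies 6 p^2 − 6 m p + m(m−1) = 0 if and only if (p, m) = (p_i, m_i) for some i ≥ 1. -/
/-- A solution with `1 ≤ P` satisfies `4 * P + 1 ≤ M ≤ 5 * P + 1`, so that its predecessor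
`(5 * P - M + 1, 6 * P - M + 1)` again lies in the region and has a smaller second coordinate. -/
theorem descent_bounds {P M : ℤ} (hP : 1 ≤ P) (hPM : 2 * P ≤ M)
    (h : 6 * P ^ 2 - 6 * M * P + M * (M - 1) = 0) :
    4 * P + 1 ≤ M ∧ M ≤ 5 * P + 1 := by
  constructor
  · by_contra! hlt
    nlinarith [mul_nonneg (sub_nonneg.2 hPM) (by lia : 0 ≤ 4 * P - M)]
  · by_contra! hlt
    obtain ⟨t, ht⟩ : ∃ t, M = 5 * P + 2 + t := ⟨M - (5 * P + 2), by ring⟩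
    have ht0 : 0 ≤ t := by lia
    subst ht
    nlinarith [mul_nonneg (by lia : 0 ≤ P) ht0, sq_nonneg t, sq_nonneg P]

/-- Every solution in the region `0 ≤ P`, `1 ≤ M`, `2 * P ≤ M` occurs in the sequence. -/
theorem exists_index_of_solution (p m : ℕ → ℤ)
    (hp1 : p 1 = 0) (hm1 : m 1 = 1)
    (hp : ∀ i ≥ 1, p (i + 1) = m i - p i)
    (hm : ∀ i ≥ 1, m (i + 1) = 5 * m i - 6 * p i + 1) (n : ℕ) :
    ∀ P M : ℤ, M ≤ n → 0 ≤ P → 1 ≤ M → 2 * P ≤ M →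
      6 * P ^ 2 - 6 * M * P + M * (M - 1) = 0 → ∃ i ≥ 1, P = p i ∧ M = m i := by
  induction n with
  | zero => intro P M hn _ hM; lia
  | succ n ih =>
    intro P M hn hP hM hPM h
    obtain rfl | hP := hP.eq_or_lt
    · refine ⟨1, le_rfl, hp1.symm, ?_⟩
      have hprod : M * (M - 1) = 0 := by linarith
      rcases mul_eq_zero.1 hprod with h0 | h0 <;> lia
    · obtain ⟨hlo, hhi⟩ := descent_bounds hP hPM h
      push_cast at hn
      obtain ⟨i, hi, hpi, hmi⟩ := ih (5 * P - M + 1) (6 * P - M + 1) (by lia) (by lia)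
        (by lia) (by lia) (by linear_combination h)
      refine ⟨i + 1, by lia, ?_, ?_⟩
      · rw [hp i hi]; lia
      · rw [hm i hi]; lia

/-- A pair (p, m) of integers with p ≥ 0, m ≥ 1 and 2p ≤ m satisfies
6 p^2 − 6 m p + m(m−1) = 0 iff it occurs in the sequence defined by
(p_1, m_1) = (0, 1), p_{i+1} = m_i − p_i, m_{i+1} = 5 m_i − 6 p_i + 1. -/
theorem stmt_2 (p m : ℕ → ℤ)
    (hp1 : p 1 = 0) (hm1 : m 1 = 1)
    (hp : ∀ i ≥ 1, p (i + 1) = m i - p i)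
    (hm : ∀ i ≥ 1, m (i + 1) = 5 * m i - 6 * p i + 1) :
    ∀ P M : ℤ, 0 ≤ P → 1 ≤ M → 2 * P ≤ M →
      (6 * P ^ 2 - 6 * M * P + M * (M - 1) = 0 ↔ ∃ i ≥ 1, P = p i ∧ M = m i) := by
  intro P M hP hM hPM
  constructor
  · exact exists_index_of_solution p m hp1 hm1 hp hm M.toNat P M (by lia) hP hM hPM
  · rintro ⟨i, hi, rfl, rfl⟩
    clear hP hM hPM
    induction i, hi using Nat.le_induction with
    | base => simp [hp1, hm1]
    | succ i hi ih =>
      rw [hp i hi, hm i hi]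
      linear_combination ih
end

section
/- For every integer i ≥ 1 define the pair (q_i, n_i) of integers by the recursion (q_1, n_1) = (1, 3), q_{i+1} = 8 n_i − 5 q_i + 1, n_{i+1} = 19 n_i − 12 q_i + 3. Then a pair (q, n) of integers with 0 ≤ q ≤ n and n ≥ 1 satisfies 3 q^2 − 6 n q + n(2n−1) = 0 if and only if (q, n) = (q_i, n_i) for some i ≥ 1. -/
/-- A solution of `3 m ^ 2 = n ^ 2 + n` with `n` positive and `m` nonnegative is carried to a smaller
nonnegative one by an automorphism of the Pell form `x ^ 2 - 12 m ^ 2`, where `x = 2 n + 1`. -/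
theorem pell_descent {n m : ℤ} (hn : 1 ≤ n) (hm : 0 ≤ m) (h : 3 * m ^ 2 = n ^ 2 + n) :
    0 ≤ 7 * n - 12 * m + 3 ∧ 7 * n - 12 * m + 3 < n ∧ 0 ≤ 7 * m - 4 * n - 2 := by
  have hn3 : 3 ≤ n := by
    by_contra! hlt
    have hm2 : m < 2 := by nlinarith
    interval_cases n <;> interval_cases m <;> omega
  refine ⟨?_, ?_, ?_⟩
  · by_contra! hlt
    nlinarith [sq_nonneg (n - 3)]
  · by_contra! hlt
    nlinarith
  · by_contra! hlt
    nlinarith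

theorem exists_index_of_pell (q n : ℕ → ℤ)
    (hq1 : q 1 = 1) (hn1 : n 1 = 3)
    (hq : ∀ i ≥ 1, q (i + 1) = 8 * n i - 5 * q i + 1)
    (hn : ∀ i ≥ 1, n (i + 1) = 19 * n i - 12 * q i + 3) (k : ℕ) :
    ∀ N M : ℤ, N.toNat = k → 1 ≤ N → 0 ≤ M → 3 * M ^ 2 = N ^ 2 + N →
      ∃ i ≥ 1, N - M = q i ∧ N = n i := by
  induction k using Nat.strong_induction_on with
  | _ k ih =>
    intro N M hk hN hM h
    obtain ⟨h0, hlt, hm⟩ := pell_descent hN hM h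
    have hpred : 3 * (7 * M - 4 * N - 2) ^ 2
        = (7 * N - 12 * M + 3) ^ 2 + (7 * N - 12 * M + 3) := by
      linear_combination h
    rcases h0.eq_or_lt with hz | hpos
    · rw [← hz] at hpred
      have hm0 : 7 * M - 4 * N - 2 = 0 := by
        have : (7 * M - 4 * N - 2) ^ 2 = 0 := by linarith
        exact pow_eq_zero_iff two_ne_zero |>.mp this
      exact ⟨1, le_rfl, by omega, by omega⟩
    · obtain ⟨i, hi, hqi, hni⟩ := ih _ (by omega) _ _ rfl hpos hm hpred
      refine ⟨i + 1, by omega, ?_, ?_⟩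
      · rw [hq i hi, ← hqi, ← hni]; ring
      · rw [hn i hi, ← hqi, ← hni]; ring


/-- A pair (q, n) of integers with 0 ≤ q ≤ n and n ≥ 1 satisfies
3 q^2 − 6 n q + n(2n−1) = 0 iff it occurs in the sequence defined by
(q_1, n_1) = (1, 3), q_{i+1} = 8 n_i − 5 q_i + 1, n_{i+1} = 19 n_i − 12 q_i + 3. -/
theorem stmt_4 (q n : ℕ → ℤ)
    (hq1 : q 1 = 1) (hn1 : n 1 = 3)
    (hq : ∀ i ≥ 1, q (i + 1) = 8 * n i - 5 * q i + 1)
    (hn : ∀ i ≥ 1, n (i + 1) = 19 * n i - 12 * q i + 3) :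
    ∀ Q N : ℤ, 0 ≤ Q → Q ≤ N → 1 ≤ N →
      (3 * Q ^ 2 - 6 * N * Q + N * (2 * N - 1) = 0 ↔ ∃ i ≥ 1, Q = q i ∧ N = n i) := by
  intro Q N hQ hQN hN
  constructor
  · intro h
    obtain ⟨i, hi, h1, h2⟩ := exists_index_of_pell q n hq1 hn1 hq hn _ N (N - Q) rfl hN
      (by omega) (by linear_combination h)
    exact ⟨i, hi, by rw [← h1]; ring, h2⟩
  · rintro ⟨i, hi, rfl, rfl⟩
    clear hQ hQN hN
    induction i, hi using Nat.le_induction with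
    | base => norm_num [hq1, hn1]
    | succ i hi ih =>
      rw [hq i hi, hn i hi]
      linear_combination ih
end

section
/- Let (p_i, m_i) be defined by the recursion (p_1, m_1) = (0, 1), p_{i+1} = m_i − p_i, m_{i+1} = 5 m_i − 6 p_i + 1, and let (q_i, n_i) be defined by the recursion (q_1, n_1) = (1, 3), q_{i+1} = 8 n_i − 5 q_i + 1, n_{i+1} = 19 n_i − 12 q_i + 3. Then for every integer i ≥ 1 one has q_i = p_{2i} and m_{2i} = 2 n_i. -/
/-- With (p_i, m_i) defined by (p_1, m_1) = (0, 1), p_{i+1} = m_i − p_i,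
m_{i+1} = 5 m_i − 6 p_i + 1, and (q_i, n_i) defined by (q_1, n_1) = (1, 3),
q_{i+1} = 8 n_i − 5 q_i + 1, n_{i+1} = 19 n_i − 12 q_i + 3, one has
q_i = p_{2i} and m_{2i} = 2 n_i for every i ≥ 1. -/
theorem stmt_5 (p m q n : ℕ → ℤ)
    (hp1 : p 1 = 0) (hm1 : m 1 = 1)
    (hp : ∀ i ≥ 1, p (i + 1) = m i - p i)
    (hm : ∀ i ≥ 1, m (i + 1) = 5 * m i - 6 * p i + 1)
    (hq1 : q 1 = 1) (hn1 : n 1 = 3)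
    (hq : ∀ i ≥ 1, q (i + 1) = 8 * n i - 5 * q i + 1)
    (hn : ∀ i ≥ 1, n (i + 1) = 19 * n i - 12 * q i + 3) :
    ∀ i ≥ 1, q i = p (2 * i) ∧ m (2 * i) = 2 * n i := by
  intro i hi
  induction i, hi using Nat.le_induction with
  | base =>
    have hp2 := hp 1 le_rfl
    have hm2 := hm 1 le_rfl
    norm_num at hp2 hm2 ⊢
    constructor <;> linarith
  | succ k hk ih =>
    obtain ⟨ihq, ihm⟩ := ih
    have hp' := hp (2 * k) (by lia)
    have hm' := hm (2 * k) (by lia)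
    have hp'' := hp (2 * k + 1) (by lia)
    have hm'' := hm (2 * k + 1) (by lia)
    rw [hq k hk, hn k hk, show 2 * (k + 1) = 2 * k + 1 + 1 by ring]
    constructor <;> linarith
end

section
/- Let m ≥ 1 and p be integers with 0 ≤ p and 2p ≤ m. Then c₁(p, m) = 0 if and only if (p, m) ∈ {(1, 15), (2, 15), (2, 16)}. -/
/-- Binomial coefficient C(a,b) for integers, with the convention that
C(a,b) = 0 whenever b < 0 or b > a, valued in ℚ. -/
def intChoose (a b : ℤ) : ℚ :=
  if 0 ≤ b ∧ b ≤ a then (Nat.choose a.toNat b.toNat : ℚ) else 0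

/-- Patodi coefficient c₁(p,m). -/
def patodiC1 (p m : ℤ) : ℚ :=
  (1 / 180) * intChoose m p - (1 / 12) * intChoose (m - 2) (p - 1)
    + (1 / 2) * intChoose (m - 4) (p - 2)

/-- Patodi coefficient c₂(p,m). -/
def patodiC2 (p m : ℤ) : ℚ :=
  -(1 / 180) * intChoose m p + (1 / 2) * intChoose (m - 2) (p - 1)
    - 2 * intChoose (m - 4) (p - 2)

/-- Patodi coefficient c₃(p,m). -/
def patodiC3 (p m : ℤ) : ℚ :=
  (1 / 72) * intChoose m p - (1 / 6) * intChoose (m - 2) (p - 1)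
    + (1 / 2) * intChoose (m - 4) (p - 2)

open Nat in
theorem intChoose_add_mul_factorial (a b : ℕ) :
    intChoose (a + b) a * (a ! * b !) = ((a + b)! : ℚ) := by
  have h : (((a : ℤ) + b).toNat) = a + b := by omega
  rw [intChoose, if_pos (by omega), h, Int.toNat_natCast, ← mul_assoc]
  rw [Nat.choose_symm_add]
  exact_mod_cast Nat.add_choose_mul_factorial_mul_factorial a b

/-- The quadratic in `p * (m - p)` to which the vanishing of `c₁(p, m)` reduces has negative
discriminant for `m ≥ 18`. -/
theorem patodi_quadratic_pos {m : ℚ} (hm : 18 ≤ m) (x : ℚ) :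
    0 < 90 * x ^ 2 - 15 * m * (m + 1) * x + m * (m - 1) * (m - 2) * (m - 3) := by
  have h : 0 < m * (3 * m ^ 3 - 58 * m ^ 2 + 83 * m - 48) := by
    obtain ⟨k, hk, rfl⟩ : ∃ k : ℚ, 0 ≤ k ∧ m = k + 18 := ⟨m - 18, by linarith, by ring⟩
    have : 0 < (k + 18) * (3 * k ^ 3 + 104 * k ^ 2 + 911 * k + 150) := by positivity
    linarith
  linarith [sq_nonneg (180 * x - 15 * m * (m + 1))]

open Nat in
theorem patodiC1_mul_factorial (a b : ℕ) :
    180 * patodiC1 (a + 2) (a + b + 4) * ((a + 2)! * (b + 2)!) =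
      (a + b)! * (90 * (((a : ℚ) + 2) * (b + 2)) ^ 2
        - 15 * (a + b + 4) * (a + b + 4 + 1) * ((a + 2) * (b + 2))
        + (a + b + 4) * (a + b + 4 - 1) * (a + b + 4 - 2) * (a + b + 4 - 3)) := by
  have h₀ := intChoose_add_mul_factorial a b
  have h₁ := intChoose_add_mul_factorial (a + 1) (b + 1)
  have h₂ := intChoose_add_mul_factorial (a + 2) (b + 2)
  rw [show a + 1 + (b + 1) = a + b + 2 by ring] at h₁
  rw [show a + 2 + (b + 2) = a + b + 4 by ring] at h₂
  simp only [Nat.factorial_succ] at h₁ h₂ ⊢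
  push_cast at h₁ h₂ ⊢
  rw [show (a : ℤ) + 1 + (b + 1) = a + b + 2 by ring] at h₁
  rw [show (a : ℤ) + 2 + (b + 2) = a + b + 4 by ring] at h₂
  rw [patodiC1, show (a : ℤ) + b + 4 - 2 = a + b + 2 by ring,
    show (a : ℤ) + b + 4 - 4 = a + b by ring, show (a : ℤ) + 2 - 1 = a + 1 by ring,
    show (a : ℤ) + 2 - 2 = a by ring]
  linear_combination h₂ - 15 * ((a : ℚ) + 2) * (b + 2) * h₁
    + 90 * ((a : ℚ) + 2) * (b + 2) * (a + 1) * (b + 1) * h₀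

theorem patodiC1_ne_zero {p m : ℤ} (hp : 0 ≤ p) (hpm : 2 * p ≤ m) (hm : 18 ≤ m) :
    patodiC1 p m ≠ 0 := by
  obtain rfl | rfl | h2 : p = 0 ∨ p = 1 ∨ 2 ≤ p := by omega
  · simp [patodiC1, intChoose, show 0 ≤ m by omega]
  · lift m to ℕ using by omega
    have h : (18 : ℚ) ≤ m := by exact_mod_cast hm
    simp only [patodiC1, intChoose]
    rw [if_pos (by omega), if_pos (by omega), if_neg (by omega)]
    norm_num
    linarith
  · obtain ⟨a, ha⟩ := Int.eq_ofNat_of_zero_le (show 0 ≤ p - 2 by omega)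
    obtain ⟨b, hb⟩ := Int.eq_ofNat_of_zero_le (show 0 ≤ m - p - 2 by omega)
    obtain rfl : p = a + 2 := by omega
    obtain rfl : m = a + b + 4 := by omega
    have hq := patodi_quadratic_pos (m := (a : ℚ) + b + 4) (by exact_mod_cast hm)
      (((a : ℚ) + 2) * (b + 2))
    have hf : (0 : ℚ) < (a + b).factorial := by positivity
    intro h0
    have h := patodiC1_mul_factorial a b
    rw [h0, mul_zero, zero_mul] at h
    exact (mul_pos hf hq).ne h

/-- For integers m ≥ 1, 0 ≤ p, 2p ≤ m, the coefficient c₁(p,m)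
vanishes iff (p,m) is one of (1,15), (2,15), (2,16). -/
theorem stmt_6 (p m : ℤ) (hm : 1 ≤ m) (hp : 0 ≤ p) (hpm : 2 * p ≤ m) :
    patodiC1 p m = 0 ↔ (p, m) = (1, 15) ∨ (p, m) = (2, 15) ∨ (p, m) = (2, 16) := by
  rcases le_or_gt 18 m with h | h
  · simp only [patodiC1_ne_zero hp hpm h, Prod.mk.injEq, false_iff]
    omega
  · have hp' : p ≤ 8 := by omega
    interval_cases m <;> interval_cases p <;> first
      | omega
      | simp [patodiC1, intChoose, Nat.choose] <;> norm_num
end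

section
/- Let m ≥ 1 and p be integers with 0 ≤ p and 2p ≤ m. Then c₁(p, m) > 0 in each of the following cases: (p = 0 and m ≥ 1 arbitrary); (p = 1 and m ≥ 16); (p = 2 and m ∉ {15, 16}); (p ≥ 3 and m arbitrary with 2p ≤ m). -/
theorem Nat.succ_mul_succ_mul_add_choose (a b : ℕ) :
    (a + 1) * (b + 1) * (a + b + 2).choose (a + 1) = (a + b + 2) * (a + b + 1) * (a + b).choose a := by
  have h := Nat.add_choose_mul_factorial_mul_factorial b a
  have h' := Nat.add_choose_mul_factorial_mul_factorial (b + 1) (a + 1)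
  rw [show b + 1 + (a + 1) = a + b + 2 by ring] at h'
  rw [add_comm b a] at h
  rw [Nat.factorial_succ (a + b + 1),
    Nat.factorial_succ (a + b), Nat.factorial_succ a, Nat.factorial_succ b, ← h] at h'
  have hpos : 0 < a.factorial * b.factorial := by positivity
  refine Nat.eq_of_mul_eq_mul_right hpos ?_
  linarith

theorem intChoose_natCast (a b : ℕ) : intChoose a b = (a.choose b : ℚ) := by
  unfold intChoose
  split_ifs with h
  · simp
  · rw [Nat.choose_eq_zero_of_lt (by omega), Nat.cast_zero]

theorem intChoose_of_neg {a b : ℤ} (hb : b < 0) : intChoose a b = 0 :=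
  if_neg fun h => absurd h.1 (by omega)

/-- The numerator of `patodiC1 p (p + q)` relative to `(p + q).choose p`. -/
def patodiC1Numerator (p q : ℤ) : ℤ :=
  (p + q) * (p + q - 1) * (p + q - 2) * (p + q - 3)
    - 15 * (p * q) * ((p + q) * (p + q + 1)) + 90 * (p * q) ^ 2

theorem patodiC1Numerator_two (q : ℤ) :
    patodiC1Numerator 2 q = q * (q - 1) * ((q - 13) * (q - 14)) := by
  unfold patodiC1Numerator
  ring

theorem patodiC1Numerator_pos_of_large {p q : ℤ} (h : 18 ≤ p + q) :
    0 < patodiC1Numerator p q := by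
  obtain ⟨n, hn⟩ : ∃ n, p + q = n + 18 := ⟨p + q - 18, by ring⟩
  have hn0 : 0 ≤ n := by omega
  have hdisc : 0 < 45 * (n + 18) * (3 * n ^ 3 + 104 * n ^ 2 + 911 * n + 150) := by positivity
  have key : 360 * patodiC1Numerator p q = (180 * (p * q) - 15 * ((n + 18) * (n + 19))) ^ 2
      + 45 * (n + 18) * (3 * n ^ 3 + 104 * n ^ 2 + 911 * n + 150) := by
    unfold patodiC1Numerator
    rw [hn]
    ring
  nlinarith [sq_nonneg (180 * (p * q) - 15 * ((n + 18) * (n + 19)))]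

theorem patodiC1Numerator_pos {p q : ℤ} (hp : 3 ≤ p) (hpq : p ≤ q) :
    0 < patodiC1Numerator p q := by
  rcases le_or_gt 18 (p + q) with h | h
  · exact patodiC1Numerator_pos_of_large h
  · have hp' : p ≤ 8 := by omega
    have hq : q ≤ 14 := by omega
    interval_cases p <;> interval_cases q <;> first | omega | norm_num [patodiC1Numerator]

theorem patodiC1_mul_eq (a b : ℕ) :
    180 * ((a + 1) * (a + 2) * (b + 1) * (b + 2)) * patodiC1 (a + 2) (a + 2 + (b + 2)) =
      (a + b).choose a * (patodiC1Numerator (a + 2) (b + 2) : ℚ) := by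
  have h := congrArg (Nat.cast (R := ℚ)) (Nat.succ_mul_succ_mul_add_choose a b)
  have h' := congrArg (Nat.cast (R := ℚ)) (Nat.succ_mul_succ_mul_add_choose (a + 1) (b + 1))
  rw [show a + 1 + (b + 1) = a + b + 2 by ring] at h'
  push_cast at h h'
  have e₁ := intChoose_natCast (a + b + 2 + 2) (a + 1 + 1)
  have e₂ := intChoose_natCast (a + b + 2) (a + 1)
  have e₃ := intChoose_natCast (a + b) a
  push_cast at e₁ e₂ e₃
  unfold patodiC1 patodiC1Numerator
  rw [show (a : ℤ) + 2 + (b + 2) - 2 = a + b + 2 by ring,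
    show (a : ℤ) + 2 + (b + 2) - 4 = a + b by ring,
    show (a : ℤ) + 2 + (b + 2) = a + b + 2 + 2 by ring,
    show (a : ℤ) + 2 - 1 = a + 1 by ring, show (a : ℤ) + 2 - 2 = a by ring,
    show (a : ℤ) + 2 = a + 1 + 1 by ring, e₁, e₂, e₃]
  push_cast
  linear_combination (a + 1) * (b + 1) * h' +
    ((a + b + 4) * (a + b + 3) - 15 * (a + 2) * (b + 2) : ℚ) * h

theorem patodiC1_pos_of_numerator_pos {p m : ℤ} (hp : 2 ≤ p) (hpm : p + 2 ≤ m)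
    (h : 0 < patodiC1Numerator p (m - p)) : 0 < patodiC1 p m := by
  obtain ⟨a, ha⟩ := Int.eq_ofNat_of_zero_le (sub_nonneg.2 hp)
  obtain ⟨b, hb⟩ := Int.eq_ofNat_of_zero_le (sub_nonneg.2 hpm)
  obtain rfl : p = a + 2 := by omega
  obtain rfl : m = a + 2 + (b + 2) := by omega
  rw [add_sub_cancel_left] at h
  have hq : (0 : ℚ) < patodiC1Numerator (a + 2) (b + 2) := by exact_mod_cast h
  have hc : (0 : ℚ) < (a + b).choose a := by exact_mod_cast Nat.choose_pos (Nat.le_add_right a b)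
  refine pos_of_mul_pos_right (patodiC1_mul_eq a b ▸ mul_pos hc hq) ?_
  positivity

theorem patodiC1_zero {m : ℤ} (hm : 0 ≤ m) : patodiC1 0 m = 1 / 180 := by
  lift m to ℕ using hm
  have h := intChoose_natCast m 0
  push_cast at h
  simp [patodiC1, h, intChoose_of_neg]

theorem patodiC1_one {m : ℤ} (hm : 2 ≤ m) : patodiC1 1 m = (m - 15) / 180 := by
  obtain ⟨n, hn⟩ := Int.eq_ofNat_of_zero_le (sub_nonneg.2 hm)
  obtain rfl : m = n + 2 := by omega
  have h₁ := intChoose_natCast (n + 2) 1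
  have h₀ := intChoose_natCast n 0
  push_cast at h₁ h₀
  rw [patodiC1, add_sub_cancel_right, sub_self, h₁, h₀, intChoose_of_neg (by norm_num)]
  simp
  ring

/-- For integers m ≥ 1, 0 ≤ p, 2p ≤ m, one has c₁(p,m) > 0 in the
cases: p = 0; p = 1 and m ≥ 16; p = 2 and m ∉ {15, 16}; p ≥ 3. -/
theorem stmt_7 (p m : ℤ) (hm : 1 ≤ m) (hp : 0 ≤ p) (hpm : 2 * p ≤ m)
    (hcase : p = 0 ∨ (p = 1 ∧ 16 ≤ m) ∨ (p = 2 ∧ m ≠ 15 ∧ m ≠ 16) ∨ 3 ≤ p) :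
    0 < patodiC1 p m := by
  rcases hcase with rfl | ⟨rfl, h⟩ | ⟨rfl, h₁, h₂⟩ | h
  · rw [patodiC1_zero (by omega)]
    norm_num
  · have hm' : (16 : ℚ) ≤ m := by exact_mod_cast h
    rw [patodiC1_one (by omega)]
    linarith
  · refine patodiC1_pos_of_numerator_pos le_rfl (by omega) ?_
    rw [patodiC1Numerator_two]
    have hr : 0 < (m - 2 - 13) * (m - 2 - 14) := by
      rcases lt_or_ge m 15 with h | h
      · exact mul_pos_of_neg_of_neg (by omega) (by omega)
      · exact mul_pos (by omega) (by omega)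
    exact mul_pos (mul_pos (by omega) (by omega)) hr
  · exact patodiC1_pos_of_numerator_pos (by omega) (by omega)
      (patodiC1Numerator_pos h (by omega))
end

section
/- Let m ≥ 2 and p be integers with 0 ≤ p and 2p ≤ m. Then the rational number 2·c₁(p,m)/(m−1) + c₂(p,m)/2 + c₃(p,m) is strictly positive in each of the following cases: (p = 0 and m ≥ 2); (p = 1 and m ≥ 3); (p ≥ 2 and m ≥ 17); (2p < m and 5 ≤ m ≤ 16). -/
/-- Removing one element from each part of a split into `q + 1` and `r + 1` elements. -/
theorem add_two_choose_succ_mul (q r : ℕ) :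
    ((q + r + 2).choose (q + 1) : ℚ) * ((q + 1) * (r + 1))
      = ((q + r).choose q : ℚ) * ((q + r + 2) * (q + r + 1)) := by
  have h₁ : (((q + r + 1 + 1) * (q + r + 1).choose q : ℕ) : ℚ)
      = ((q + r + 1 + 1).choose (q + 1) * (q + 1) : ℕ) := by
    exact_mod_cast Nat.add_one_mul_choose_eq (q + r + 1) q
  have h₂ := Nat.choose_mul_succ_eq (q + r) q
  rw [show q + r + 1 - q = r + 1 by omega] at h₂
  have h₂' : (((q + r).choose q * (q + r + 1) : ℕ) : ℚ)
      = ((q + r + 1).choose q * (r + 1) : ℕ) := by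
    exact_mod_cast h₂
  push_cast at h₁ h₂'
  linear_combination -((r : ℚ) + 1) * h₁ - ((q : ℚ) + r + 2) * h₂'

theorem patodi_combination_eq (p m : ℤ) (hm : 2 ≤ m) :
    2 * patodiC1 p m / ((m : ℚ) - 1) + patodiC2 p m / 2 + patodiC3 p m
      = (2 * m * intChoose m p + 15 * (m - 3) * intChoose (m - 2) (p - 1)
          - 90 * (m - 3) * intChoose (m - 4) (p - 2)) / (180 * ((m : ℚ) - 1)) := by
  have hm' : (2 : ℚ) ≤ m := by exact_mod_cast hm
  have h : (m : ℚ) - 1 ≠ 0 := by linarith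
  unfold patodiC1 patodiC2 patodiC3
  field_simp
  ring

/-- The quartic controlling the sign of the Patodi combination is positive. -/
theorem patodi_quartic_pos (p m : ℤ) (hp : 2 ≤ p) (hpm : 2 * p ≤ m)
    (h : 17 ≤ m ∨ (2 * p < m ∧ m ≤ 16)) :
    0 < 2 * m ^ 2 * (m - 1) * (m - 2) + 15 * (m - 3) * (m - 2) * (p * (m - p))
      - 90 * (p * (m - p)) * ((p - 1) * (m - p - 1)) := by
  rcases h with h | ⟨h, h'⟩
  · have hx : 0 < p * (m - p) := mul_pos (by omega) (by omega)
    have h₁ : 0 < p * (m - p) * ((m - 16) * (m - 2)) :=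
      mul_pos hx (mul_pos (by omega) (by omega))
    have h₂ : 0 ≤ (m - 1) * (m - 2) * (m - 2 * p) ^ 2 :=
      mul_nonneg (mul_nonneg (by omega) (by omega)) (sq_nonneg _)
    have h₃ : 0 ≤ p * (m - p) * (m - 2 * p) ^ 2 := mul_nonneg hx.le (sq_nonneg _)
    linarith
  · have hp' : p ≤ 7 := by omega
    interval_cases p <;> interval_cases m <;> norm_num

theorem patodi_numerator_pos (q r : ℕ) (hqr : q ≤ r)
    (h : 17 ≤ q + r + 4 ∨ (q < r ∧ q + r + 4 ≤ 16)) :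
    0 < 2 * ((q : ℚ) + r + 4) * (q + r + 4).choose (q + 2)
      + 15 * ((q : ℚ) + r + 1) * (q + r + 2).choose (q + 1)
      - 90 * ((q : ℚ) + r + 1) * (q + r).choose q := by
  have hb := add_two_choose_succ_mul q r
  have ha := add_two_choose_succ_mul (q + 1) (r + 1)
  rw [show q + 1 + (r + 1) + 2 = q + r + 4 by omega, show q + 1 + (r + 1) = q + r + 2 by omega,
    show q + 1 + 1 = q + 2 by omega] at ha
  push_cast at ha
  have hc : (0 : ℚ) < (q + r).choose q := by exact_mod_cast Nat.choose_pos (by omega)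
  have hF := patodi_quartic_pos (q + 2) (q + r + 4) (by omega) (by omega) (by omega)
  have hF' := Int.cast_pos (R := ℚ).2 hF
  push_cast at hF'
  generalize ((q + r + 4).choose (q + 2) : ℚ) = a at *
  generalize ((q + r + 2).choose (q + 1) : ℚ) = b at *
  generalize ((q + r).choose q : ℚ) = c at *
  have hD : (0 : ℚ) < (q + 2) * (r + 2) * ((q + 1) * (r + 1)) := by positivity
  have hk := mul_pos (mul_pos hc (show (0 : ℚ) < q + r + 1 by positivity)) hF'
  refine pos_of_mul_pos_left (b := ((q : ℚ) + 2) * (r + 2) * ((q + 1) * (r + 1))) ?_ hD.le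
  refine hk.trans_eq ?_
  linear_combination
    -(2 * ((q : ℚ) + r + 4) * ((q + 1) * (r + 1))) * ha
    - (2 * ((q : ℚ) + r + 4) * ((q + r + 4) * (q + r + 3))
      + 15 * ((q : ℚ) + r + 1) * ((q + 2) * (r + 2))) * hb

/-- For integers m ≥ 2, 0 ≤ p, 2p ≤ m, the rational number
2·c₁(p,m)/(m−1) + c₂(p,m)/2 + c₃(p,m) is strictly positive in the cases:
p = 0 and m ≥ 2; p = 1 and m ≥ 3; p ≥ 2 and m ≥ 17; 2p < m and 5 ≤ m ≤ 16. -/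
theorem stmt_8 (p m : ℤ) (hm : 2 ≤ m) (hp : 0 ≤ p) (hpm : 2 * p ≤ m)
    (hcase : p = 0 ∨ (p = 1 ∧ 3 ≤ m) ∨ (2 ≤ p ∧ 17 ≤ m) ∨ (2 * p < m ∧ 5 ≤ m ∧ m ≤ 16)) :
    0 < 2 * patodiC1 p m / ((m : ℚ) - 1) + patodiC2 p m / 2 + patodiC3 p m := by
  rw [patodi_combination_eq p m hm]
  have hm' : (2 : ℚ) ≤ m := by exact_mod_cast hm
  refine div_pos ?_ (by linarith)
  obtain rfl | rfl | hp2 : p = 0 ∨ p = 1 ∨ 2 ≤ p := by omega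
  · have h : 0 ≤ m := by omega
    simp [intChoose, h]
    linarith
  · have h3 : (3 : ℚ) ≤ m := by exact_mod_cast (show (3 : ℤ) ≤ m by omega)
    have h : 1 ≤ m := by omega
    simp only [intChoose]
    norm_num [h, hm, show (m.toNat : ℚ) = m by exact_mod_cast Int.toNat_of_nonneg (by omega)]
    nlinarith
  · obtain ⟨q, rfl⟩ : ∃ q : ℕ, p = q + 2 := ⟨(p - 2).toNat, by omega⟩
    obtain ⟨r, rfl⟩ : ∃ r : ℕ, m = q + r + 4 := ⟨(m - q - 4).toNat, by omega⟩
    have key := patodi_numerator_pos q r (by omega) (by omega)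
    rw [show (q : ℤ) + r + 4 - 2 = (q + r + 2 : ℕ) by push_cast; ring,
      show (q : ℤ) + r + 4 - 4 = (q + r : ℕ) by push_cast; ring,
      show (q : ℤ) + 2 - 1 = (q + 1 : ℕ) by push_cast; ring,
      show (q : ℤ) + 2 - 2 = (q : ℕ) by ring,
      show (q : ℤ) + r + 4 = (q + r + 4 : ℕ) by push_cast; ring,
      show (q : ℤ) + 2 = (q + 2 : ℕ) by push_cast; ring]
    simp only [intChoose_natCast]
    push_cast
    linarith
end

section
/- Let n ≥ 2 and p be integers with 0 ≤ p ≤ n, and set m = 2n. Then the rational number ((4n+2)/((n+1)(n+2)))·c₁(p, 2n) + c₂(p, 2n)/2 + c₃(p, 2n) is strictly positive. -/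
theorem intChoose_pos {a b : ℤ} (hb : 0 ≤ b) (hba : b ≤ a) : 0 < intChoose a b := by
  rw [intChoose, if_pos ⟨hb, hba⟩]
  exact_mod_cast Nat.choose_pos (Int.toNat_le_toNat hba)

theorem choose_add_two_succ_mul (b c : ℕ) :
    (b + c + 2).choose (b + 1) * ((b + 1) * (c + 1))
      = (b + c + 2) * (b + c + 1) * (b + c).choose b := by
  have h₁ := Nat.add_one_mul_choose_eq (b + c + 1) b
  have h₂ := Nat.choose_mul_succ_eq (b + c) b
  rw [show b + c + 1 - b = c + 1 by omega] at h₂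
  calc (b + c + 2).choose (b + 1) * ((b + 1) * (c + 1))
      = ((b + c + 1 + 1).choose (b + 1) * (b + 1)) * (c + 1) := by ring
    _ = (b + c + 2) * ((b + c + 1).choose b * (c + 1)) := by rw [← h₁]; ring
    _ = (b + c + 2) * (b + c + 1) * (b + c).choose b := by rw [← h₂]; ring

theorem intChoose_mul_eq {m : ℤ} (hm : 2 ≤ m) (p : ℤ) :
    intChoose m p * (p * (m - p)) = m * (m - 1) * intChoose (m - 2) (p - 1) := by
  by_cases h : 1 ≤ p ∧ p < m
  · obtain ⟨b, hb⟩ := Int.eq_ofNat_of_zero_le (show 0 ≤ p - 1 by omega)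
    obtain ⟨c, hc⟩ := Int.eq_ofNat_of_zero_le (show 0 ≤ m - p - 1 by omega)
    obtain rfl : p = b + 1 := by omega
    obtain rfl : m = b + c + 2 := by omega
    rw [intChoose, intChoose, if_pos (by omega), if_pos (by omega),
      show ((b : ℤ) + c + 2).toNat = b + c + 2 by omega, show ((b : ℤ) + 1).toNat = b + 1 by omega,
      show ((b : ℤ) + c + 2 - 2).toNat = b + c by omega,
      show ((b : ℤ) + 1 - 1).toNat = b by omega]
    have key : ((b + c + 2).choose (b + 1) * ((b + 1) * (c + 1)) : ℚ)
        = (b + c + 2) * (b + c + 1) * (b + c).choose b := by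
      exact_mod_cast choose_add_two_succ_mul b c
    push_cast
    linear_combination key
  · have h₀ : intChoose (m - 2) (p - 1) = 0 := if_neg (by omega)
    rw [h₀, mul_zero]
    by_cases hp : 0 ≤ p ∧ p ≤ m
    · obtain rfl | rfl : p = 0 ∨ p = m := by omega
      · simp
      · simp
    · simp [intChoose, if_neg hp]

theorem quartic_add_quadratic_pos {n x : ℚ} (hn : 2 ≤ n) (hx : 0 ≤ x) (hxn : x ≤ n ^ 2) :
    0 < 4 * (n ^ 2 + 5 * n + 3) * ((2 * n - 1) * (2 * n - 3)) + 15 * x * (2 * n ^ 2 + n - 3 * x) := by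
  have h₁ : 0 ≤ x * (n ^ 2 - x) := mul_nonneg hx (by linarith)
  have h₂ : 0 ≤ (n ^ 2 - x) * (n * (n - 1)) :=
    mul_nonneg (by linarith) (mul_nonneg (by linarith) (by linarith))
  have h₃ : 0 < n ^ 4 + 63 * n ^ 3 - 100 * n ^ 2 - 36 * n + 36 := by
    obtain ⟨t, rfl⟩ : ∃ t, n = t + 2 := ⟨n - 2, by ring⟩
    have ht : 0 ≤ t := by linarith
    ring_nf
    positivity
  linarith

/-- For integers n ≥ 2 and 0 ≤ p ≤ n, with m = 2n, the rational
number ((4n+2)/((n+1)(n+2)))·c₁(p,2n) + c₂(p,2n)/2 + c₃(p,2n) is strictly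
positive. -/
theorem stmt_9 (n p : ℤ) (hn : 2 ≤ n) (hp : 0 ≤ p) (hpn : p ≤ n) :
    0 < ((4 * (n : ℚ) + 2) / (((n : ℚ) + 1) * ((n : ℚ) + 2))) * patodiC1 p (2 * n)
        + patodiC2 p (2 * n) / 2 + patodiC3 p (2 * n) := by
  have hnq : (2 : ℚ) ≤ n := by exact_mod_cast hn
  have hpq : (0 : ℚ) ≤ p := by exact_mod_cast hp
  have hpnq : (p : ℚ) ≤ n := by exact_mod_cast hpn
  have hA : 0 < intChoose (2 * n) p := intChoose_pos hp (by omega)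
  have hB := intChoose_mul_eq (show 2 ≤ 2 * n by omega) p
  have hD := intChoose_mul_eq (show 2 ≤ 2 * n - 2 by omega) (p - 1)
  rw [show 2 * n - 2 - 2 = 2 * n - 4 by ring, show p - 1 - 1 = p - 2 by ring] at hD
  push_cast at hB hD
  have hP := quartic_add_quadratic_pos (x := p * (2 * n - p)) hnq
    (mul_nonneg hpq (by linarith)) (by nlinarith [sq_nonneg ((n : ℚ) - p)])
  rw [patodiC1, patodiC2, patodiC3]
  generalize intChoose (2 * n) p = A at *
  generalize intChoose (2 * n - 2) (p - 1) = B at *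
  generalize intChoose (2 * n - 4) (p - 2) = D at *
  generalize (n : ℚ) = n at *
  generalize (p : ℚ) = p at *
  have h₀ : 0 < n := by linarith
  have h₁ : 0 < n - 1 := by linarith
  have h₂ : 0 < 2 * n - 1 := by linarith
  have h₃ : 0 < 2 * n - 3 := by linarith
  have hB' : B = A * (p * (2 * n - p)) / (2 * n * (2 * n - 1)) := by
    rw [eq_div_iff (by positivity)]
    linear_combination -hB
  have hD' : D = B * ((p - 1) * (2 * n - p - 1)) / (2 * (n - 1) * (2 * n - 3)) := by
    rw [eq_div_iff (by positivity)]
    linear_combination -hD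
  refine lt_of_lt_of_eq (div_pos (mul_pos hA hP)
    (show 0 < 360 * ((2 * n - 1) * (2 * n - 3)) * ((n + 1) * (n + 2)) by positivity)) ?_
  rw [hD', hB']
  obtain ⟨a, ha⟩ : ∃ a, a = 2 * n - 1 := ⟨_, rfl⟩
  obtain ⟨b, hb⟩ : ∃ b, b = 2 * n - 3 := ⟨_, rfl⟩
  rw [← ha] at h₂ ⊢
  rw [← hb] at h₃ ⊢
  have h₁' := h₁.ne'
  field_simp
  rw [ha, hb]
  ring
end

section
/- Let m ≥ 5 be an integer and define f : ℝ → ℝ by f(p) = α·m(m−1)(m−2)(m−3) + β·(m−2)(m−3)·p(m−p) + γ·p(p−1)(m−p)(m−p−1), where α = m/(90(m−1)), β = (m−3)/(12(m−1)) and γ = −(m−3)/(2(m−1)). Then for every real number p with 2 ≤ p ≤ m−2 one has f(p) ≥ min(f(2), f(m/2)). -/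
/-- A concave quadratic on an interval is bounded below by the smaller of its endpoint values. -/
theorem min_le_concave_quadratic {γ a b s : ℝ} (hγ : γ ≤ 0) (A B : ℝ) (has : a ≤ s)
    (hsb : s ≤ b) :
    min (A + B * a + γ * a ^ 2) (A + B * b + γ * b ^ 2) ≤ A + B * s + γ * s ^ 2 := by
  rcases le_total 0 (B + γ * (s + a)) with h | h
  · refine min_le_of_left_le ?_
    nlinarith [mul_nonneg (sub_nonneg.2 has) h]
  · refine min_le_of_right_le ?_
    have h' : B + γ * (s + b) ≤ 0 := by
      nlinarith [mul_nonneg_of_nonpos_of_nonpos hγ (sub_nonpos.2 (has.trans hsb))]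
    nlinarith [mul_nonneg_of_nonpos_of_nonpos (sub_nonpos.2 hsb) h']

/-- For an integer m ≥ 5, with α = m/(90(m−1)), β = (m−3)/(12(m−1)),
γ = −(m−3)/(2(m−1)) and
f(p) = α·m(m−1)(m−2)(m−3) + β·(m−2)(m−3)·p(m−p) + γ·p(p−1)(m−p)(m−p−1),
for every real p with 2 ≤ p ≤ m − 2 one has f(p) ≥ min(f(2), f(m/2)). -/
theorem stmt_11 (m : ℤ) (hm : 5 ≤ m)
    (α β γ : ℝ)
    (hα : α = (m : ℝ) / (90 * ((m : ℝ) - 1)))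
    (hβ : β = ((m : ℝ) - 3) / (12 * ((m : ℝ) - 1)))
    (hγ : γ = -((m : ℝ) - 3) / (2 * ((m : ℝ) - 1)))
    (f : ℝ → ℝ)
    (hf : ∀ p : ℝ, f p = α * ((m : ℝ) * ((m : ℝ) - 1) * ((m : ℝ) - 2) * ((m : ℝ) - 3))
      + β * (((m : ℝ) - 2) * ((m : ℝ) - 3)) * (p * ((m : ℝ) - p))
      + γ * (p * (p - 1) * ((m : ℝ) - p) * ((m : ℝ) - p - 1))) :
    ∀ p : ℝ, 2 ≤ p → p ≤ (m : ℝ) - 2 → min (f 2) (f ((m : ℝ) / 2)) ≤ f p := by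
  intro p hp2 hpm
  have hm' : (5 : ℝ) ≤ m := by exact_mod_cast hm
  have hγ0 : γ ≤ 0 := by
    rw [hγ]
    exact div_nonpos_of_nonpos_of_nonneg (by linarith) (by linarith)
  have hconc := min_le_concave_quadratic hγ0
    (α * ((m : ℝ) * (m - 1) * (m - 2) * (m - 3)))
    (β * (((m : ℝ) - 2) * (m - 3)) - γ * (m - 1))
    (a := 2 * ((m : ℝ) - 2)) (b := m / 2 * (m - m / 2)) (s := p * (m - p))
    (by nlinarith [mul_nonneg (sub_nonneg.2 hp2) (sub_nonneg.2 hpm)])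
    (by nlinarith [sq_nonneg (p - m / 2)])
  have hquad : ∀ q : ℝ, f q = α * ((m : ℝ) * (m - 1) * (m - 2) * (m - 3))
      + (β * (((m : ℝ) - 2) * (m - 3)) - γ * (m - 1)) * (q * (m - q))
      + γ * (q * (m - q)) ^ 2 := fun q => by rw [hf]; ring
  rwa [hquad, hquad, hquad p]
end

section
/- Let m be a positive integer, α < 1 a real number, C₀ > 0 a real number, and (λ_i)_{i≥1} a sequence of real numbers such that λ_i/i^{2/m} converges to C₀ as i → ∞. Then for every t > 0 the series ω(t) = Σ_{i=1}^{∞} e^{−λ_i t}·i^{−α} converges, and limsup_{t→0⁺} t^{(m/2)(1−α)}·ω(t) ≤ ∫₀^{∞} e^{−C₀ s^{2/m}}·s^{−α} ds, where the integral on the right-hand side is finite. -/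
open Filter Topology MeasureTheory

/-- The sum of a sequence is the integral of the associated step function. -/
theorem hasSum_integral_comp_floor {g : ℕ → ℝ}
    (hg : IntegrableOn (fun x : ℝ => g ⌊x⌋₊) (Set.Ioi 0)) :
    HasSum g (∫ x in Set.Ioi (0 : ℝ), g ⌊x⌋₊) := by
  have hU : (⋃ n : ℕ, Set.Ico (n : ℝ) (n + 1)) = Set.Ici 0 := by
    ext x
    simp only [Set.mem_iUnion, Set.mem_Ico, Set.mem_Ici]
    constructor
    · rintro ⟨n, h, -⟩
      exact (Nat.cast_nonneg n).trans h
    · intro hx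
      exact ⟨⌊x⌋₊, Nat.floor_le hx, Nat.lt_floor_add_one x⟩
  have hd : Pairwise (Function.onFun Disjoint fun n : ℕ => Set.Ico (n : ℝ) (n + 1)) := by
    intro a b hab
    refine Set.disjoint_left.2 fun x hxa hxb => hab ?_
    rw [← Nat.floor_eq_on_Ico a x hxa, Nat.floor_eq_on_Ico b x hxb]
  have h := hasSum_integral_iUnion (μ := volume) (f := fun x : ℝ => g ⌊x⌋₊)
    (s := fun n : ℕ => Set.Ico (n : ℝ) (n + 1)) (fun _ => measurableSet_Ico) hd
    (by rw [hU]; exact (integrableOn_Ici_iff_integrableOn_Ioi (by simp)).2 hg)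
  rw [hU, integral_Ici_eq_integral_Ioi] at h
  have hn : (fun n : ℕ => ∫ x in Set.Ico (n : ℝ) (n + 1), g ⌊x⌋₊) = g := by
    funext n
    have hc : Set.EqOn (fun x : ℝ => g ⌊x⌋₊) (fun _ => g n) (Set.Ico (n : ℝ) (n + 1)) :=
      fun x hx => by simp only [Nat.floor_eq_on_Ico n x hx]
    rw [setIntegral_congr_fun measurableSet_Ico hc]
    simp
  rwa [hn] at h

/-- The step function on `(0, ∞)` of mesh `h` whose integral is
`h ∑ exp (-l n h ^ β) (n h) ^ (-α)`. -/
noncomputable def rescaledStep (l : ℕ → ℝ) (α β h s : ℝ) : ℝ :=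
  Real.exp (-(l (⌊s / h⌋₊ + 1)) * h ^ β) * (((⌊s / h⌋₊ : ℝ) + 1) * h) ^ (-α)

theorem measurable_rescaledStep (l : ℕ → ℝ) (α β h : ℝ) :
    Measurable (rescaledStep l α β h) :=
  (measurable_from_nat (f := fun n : ℕ =>
      Real.exp (-(l (n + 1)) * h ^ β) * (((n : ℝ) + 1) * h) ^ (-α))).comp
    (Nat.measurable_floor.comp (measurable_id.div_const h))

theorem lt_floor_div_add_one_mul {h : ℝ} (hh : 0 < h) (s : ℝ) :
    s < ((⌊s / h⌋₊ : ℝ) + 1) * h :=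
  (div_lt_iff₀ hh).1 (Nat.lt_floor_add_one _)

theorem floor_div_add_one_mul_le {h s : ℝ} (hh : 0 < h) (hs : 0 ≤ s) :
    ((⌊s / h⌋₊ : ℝ) + 1) * h ≤ s + h := by
  have := (le_div_iff₀ hh).1 (Nat.floor_le (div_nonneg hs hh.le))
  linarith

theorem rpow_le_of_mem_Icc {s x H p : ℝ} (hs : 0 < s) (hH : 0 ≤ H) (hsx : s ≤ x)
    (hx : x ≤ s + H) : x ^ p ≤ s ^ p + 2 ^ p * (s ^ p + H ^ p) := by
  have hsp : 0 ≤ s ^ p := by positivity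
  have hHp : 0 ≤ H ^ p := by positivity
  have h2p : (0 : ℝ) ≤ 2 ^ p := by positivity
  rcases le_total p 0 with hp | hp
  · have := Real.rpow_le_rpow_of_nonpos hs hsx hp
    nlinarith [mul_nonneg h2p (add_nonneg hsp hHp)]
  · have hmax : max s H ^ p ≤ s ^ p + H ^ p := by
      rcases max_choice s H with h | h <;> rw [h] <;> linarith
    calc x ^ p ≤ (2 * max s H) ^ p := by
          refine Real.rpow_le_rpow (hs.le.trans hsx) ?_ hp
          linarith [le_max_left s H, le_max_right s H]
      _ = 2 ^ p * max s H ^ p := Real.mul_rpow zero_le_two (hs.le.trans (le_max_left _ _))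
      _ ≤ 2 ^ p * (s ^ p + H ^ p) := mul_le_mul_of_nonneg_left hmax h2p
      _ ≤ _ := by linarith

/-- A sequence asymptotic to `C₀ n ^ β` dominates `(C₀ / 2) n ^ β` up to a constant. -/
theorem exists_half_mul_rpow_le_add {β C₀ : ℝ} (hC₀ : 0 < C₀) {l : ℕ → ℝ}
    (hl : Tendsto (fun i : ℕ => l i / (i : ℝ) ^ β) atTop (𝓝 C₀)) :
    ∃ M : ℝ, 0 ≤ M ∧ ∀ n : ℕ, C₀ / 2 * (n : ℝ) ^ β ≤ l n + M := by
  have hev : ∀ᶠ n : ℕ in atTop, C₀ / 2 * (n : ℝ) ^ β - l n ≤ 0 := by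
    filter_upwards [hl.eventually_const_lt (half_lt_self hC₀), eventually_gt_atTop 0] with n hn h0
    have : (0 : ℝ) < (n : ℝ) ^ β := Real.rpow_pos_of_pos (Nat.cast_pos.2 h0) _
    linarith [(lt_div_iff₀ this).1 hn]
  obtain ⟨M, hM⟩ := IsBoundedUnder.bddAbove_range
    (f := fun n : ℕ => C₀ / 2 * (n : ℝ) ^ β - l n) ⟨0, hev⟩
  refine ⟨max M 0, le_max_right _ _, fun n => ?_⟩
  have := hM (Set.mem_range_self n)
  linarith [le_max_left M 0]

theorem integrableOn_exp_neg_mul_rpow_mul_rpow {β c p : ℝ} (hβ : 0 < β) (hc : 0 < c)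
    (hp : -1 < p) :
    IntegrableOn (fun s : ℝ => Real.exp (-c * s ^ β) * s ^ p) (Set.Ioi 0) := by
  simpa only [mul_comm] using integrableOn_rpow_mul_exp_neg_mul_rpow hp hβ hc

theorem exists_integrableOn_bound_rescaledStep {α β C₀ : ℝ} (hα : α < 1) (hβ : 0 < β)
    (hC₀ : 0 < C₀) {l : ℕ → ℝ}
    (hl : Tendsto (fun i : ℕ => l i / (i : ℝ) ^ β) atTop (𝓝 C₀)) {H : ℝ} (hH : 0 < H) :
    ∃ G : ℝ → ℝ, IntegrableOn G (Set.Ioi 0) ∧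
      ∀ h, 0 < h → h ≤ H → ∀ s, 0 < s → ‖rescaledStep l α β h s‖ ≤ G s := by
  obtain ⟨M, hM0, hM⟩ := exists_half_mul_rpow_le_add hC₀ hl
  refine ⟨fun s => Real.exp (M * H ^ β) * ((1 + 2 ^ (-α)) *
      (Real.exp (-(C₀ / 2) * s ^ β) * s ^ (-α)) +
      2 ^ (-α) * H ^ (-α) * (Real.exp (-(C₀ / 2) * s ^ β) * s ^ (0 : ℝ))), ?_, ?_⟩
  · exact (((integrableOn_exp_neg_mul_rpow_mul_rpow hβ (half_pos hC₀)
      (by linarith)).const_mul _).add ((integrableOn_exp_neg_mul_rpow_mul_rpow hβ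
      (half_pos hC₀) (by norm_num)).const_mul _)).const_mul _
  · intro h hh hhH s hs
    have hlow := lt_floor_div_add_one_mul hh s
    have hup := floor_div_add_one_mul_le hh hs.le
    have hn := hM (⌊s / h⌋₊ + 1)
    push_cast at hn
    unfold rescaledStep
    set n : ℕ := ⌊s / h⌋₊
    have hpow := rpow_le_of_mem_Icc (p := -α) hs hH.le hlow.le (hup.trans (by linarith))
    have hhβ : 0 < h ^ β := Real.rpow_pos_of_pos hh _
    have hexp : Real.exp (-(l (n + 1)) * h ^ β) ≤
        Real.exp (M * H ^ β) * Real.exp (-(C₀ / 2) * s ^ β) := by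
      rw [← Real.exp_add]
      refine Real.exp_le_exp.2 ?_
      have h1 : s ^ β ≤ ((n : ℝ) + 1) ^ β * h ^ β := by
        rw [← Real.mul_rpow (by positivity) hh.le]
        exact Real.rpow_le_rpow hs.le hlow.le hβ.le
      have h2 : h ^ β ≤ H ^ β := Real.rpow_le_rpow hh.le hhH hβ.le
      nlinarith [mul_le_mul_of_nonneg_right hn hhβ.le, mul_le_mul_of_nonneg_left h2 hM0,
        mul_le_mul_of_nonneg_left h1 (half_pos hC₀).le]
    rw [Real.norm_of_nonneg (by positivity)]
    calc _ ≤ _ := mul_le_mul hexp hpow (by positivity) (by positivity)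
      _ = _ := by simp only [Real.rpow_zero]; ring

theorem tendsto_rescaledStep {α β C₀ : ℝ} {l : ℕ → ℝ}
    (hl : Tendsto (fun i : ℕ => l i / (i : ℝ) ^ β) atTop (𝓝 C₀)) {s : ℝ} (hs : 0 < s) :
    Tendsto (fun h => rescaledStep l α β h s) (𝓝[>] 0)
      (𝓝 (Real.exp (-C₀ * s ^ β) * s ^ (-α))) := by
  have hpos : ∀ᶠ h : ℝ in 𝓝[>] 0, 0 < h := eventually_mem_nhdsWithin
  have hx : Tendsto (fun h : ℝ => ((⌊s / h⌋₊ : ℝ) + 1) * h) (𝓝[>] 0) (𝓝 s) := by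
    have hu : Tendsto (fun h : ℝ => s + h) (𝓝[>] 0) (𝓝 s) := by
      have : Tendsto (fun h : ℝ => s + h) (𝓝 0) (𝓝 (s + 0)) :=
        (continuous_const_add s).tendsto 0
      rw [add_zero] at this
      exact this.mono_left nhdsWithin_le_nhds
    refine tendsto_of_tendsto_of_tendsto_of_le_of_le' tendsto_const_nhds hu ?_ ?_
    · filter_upwards [hpos] with h hh using (lt_floor_div_add_one_mul hh s).le
    · filter_upwards [hpos] with h hh using floor_div_add_one_mul_le hh hs.le
  have hn : Tendsto (fun h : ℝ => ⌊s / h⌋₊ + 1) (𝓝[>] 0) atTop := by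
    refine (tendsto_add_atTop_nat 1).comp (tendsto_nat_floor_atTop.comp ?_)
    exact (tendsto_inv_nhdsGT_zero.const_mul_atTop hs).congr fun h => (div_eq_mul_inv s h).symm
  have hq := (hl.comp hn).neg.mul (hx.rpow_const (p := β) (Or.inl hs.ne'))
  refine (((Real.continuous_exp.tendsto _).comp hq).mul
    (hx.rpow_const (p := -α) (Or.inl hs.ne'))).congr' ?_
  filter_upwards [hpos] with h hh
  have h1 : (0 : ℝ) < (⌊s / h⌋₊ : ℝ) + 1 := by positivity
  have h2 := (Real.rpow_pos_of_pos h1 β).ne'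
  simp only [Function.comp_apply, rescaledStep, Nat.cast_add, Nat.cast_one]
  rw [Real.mul_rpow (z := β) h1.le hh.le]
  congr 2
  field_simp

theorem integrableOn_rescaledStep {α β C₀ : ℝ} (hα : α < 1) (hβ : 0 < β)
    (hC₀ : 0 < C₀) {l : ℕ → ℝ}
    (hl : Tendsto (fun i : ℕ => l i / (i : ℝ) ^ β) atTop (𝓝 C₀)) {h : ℝ} (hh : 0 < h) :
    IntegrableOn (rescaledStep l α β h) (Set.Ioi 0) := by
  obtain ⟨G, hG, hb⟩ := exists_integrableOn_bound_rescaledStep hα hβ hC₀ hl hh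
  refine Integrable.mono' hG (measurable_rescaledStep l α β h).aestronglyMeasurable ?_
  filter_upwards [ae_restrict_mem measurableSet_Ioi] with s hs using hb h hh le_rfl s hs

theorem hasSum_integral_rescaledStep {α β h : ℝ} {l : ℕ → ℝ} (hh : 0 < h)
    (hi : IntegrableOn (rescaledStep l α β h) (Set.Ioi 0)) :
    HasSum (fun i : ℕ => h ^ (1 - α) * (Real.exp (-(l (i + 1)) * h ^ β) * ((i : ℝ) + 1) ^ (-α)))
      (∫ s in Set.Ioi (0 : ℝ), rescaledStep l α β h s) := by
  set g : ℕ → ℝ := fun n => Real.exp (-(l (n + 1)) * h ^ β) * (((n : ℝ) + 1) * h) ^ (-α) with hg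
  have hcomp : (fun x => rescaledStep l α β h (h * x)) = fun x : ℝ => g ⌊x⌋₊ := by
    funext x
    simp only [hg, rescaledStep, mul_div_cancel_left₀ x hh.ne']
  have hi' := (integrableOn_Ioi_comp_mul_left_iff (rescaledStep l α β h) 0 hh).2
    (by rwa [mul_zero])
  have hint := integral_comp_mul_left_Ioi (rescaledStep l α β h) 0 hh
  rw [hcomp] at hi'
  rw [hcomp, mul_zero, smul_eq_mul] at hint
  have hsum := (hasSum_integral_comp_floor hi').mul_left h
  rw [hint, mul_inv_cancel_left₀ hh.ne'] at hsum
  refine (congrArg (fun f => HasSum f _) (funext fun i => ?_)).mp hsum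
  simp only [hg]
  rw [Real.mul_rpow (by positivity) hh.le, sub_eq_add_neg, Real.rpow_add hh, Real.rpow_one]
  ring

/-- If λ_i/i^{2/m} → C₀ > 0 and α < 1, then for every t > 0 the series
ω(t) = Σ_{i=1}^∞ e^{−λ_i t}·i^{−α} converges, and
limsup_{t→0⁺} t^{(m/2)(1−α)}·ω(t) ≤ ∫₀^∞ e^{−C₀ s^{2/m}}·s^{−α} ds, this
integral being finite. -/
theorem stmt_14 (m : ℕ) (hm : 0 < m) (α : ℝ) (hα : α < 1) (C₀ : ℝ) (hC₀ : 0 < C₀)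
    (l : ℕ → ℝ)
    (hl : Tendsto (fun i : ℕ => l i / (i : ℝ) ^ ((2 : ℝ) / m)) atTop (𝓝 C₀)) :
    (∀ t : ℝ, 0 < t →
      Summable (fun i : ℕ => Real.exp (-(l (i + 1)) * t) * ((i : ℝ) + 1) ^ (-α))) ∧
    IntegrableOn (fun s : ℝ => Real.exp (-C₀ * s ^ ((2 : ℝ) / m)) * s ^ (-α))
      (Set.Ioi 0) ∧
    Filter.limsup
      (fun t : ℝ =>
        ((t ^ (((m : ℝ) / 2) * (1 - α))
          * ∑' i : ℕ, Real.exp (-(l (i + 1)) * t) * ((i : ℝ) + 1) ^ (-α) : ℝ) : EReal))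
      (𝓝[>] (0 : ℝ))
      ≤ ((∫ s in Set.Ioi (0 : ℝ),
          Real.exp (-C₀ * s ^ ((2 : ℝ) / m)) * s ^ (-α) : ℝ) : EReal) := by
  have hm' : (0 : ℝ) < m := Nat.cast_pos.2 hm
  have hβ : (0 : ℝ) < 2 / m := by positivity
  have hpos : ∀ t : ℝ, 0 < t → 0 < t ^ ((m : ℝ) / 2) := fun t ht => Real.rpow_pos_of_pos ht _
  have hroot : ∀ t : ℝ, 0 < t → (t ^ ((m : ℝ) / 2)) ^ ((2 : ℝ) / m) = t := fun t ht => by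
    rw [← Real.rpow_mul ht.le, show (m : ℝ) / 2 * (2 / m) = 1 by field_simp, Real.rpow_one]
  have hsum : ∀ t : ℝ, 0 < t → HasSum
      (fun i : ℕ => t ^ (((m : ℝ) / 2) * (1 - α)) *
        (Real.exp (-(l (i + 1)) * t) * ((i : ℝ) + 1) ^ (-α)))
      (∫ s in Set.Ioi (0 : ℝ), rescaledStep l α (2 / m) (t ^ ((m : ℝ) / 2)) s) := fun t ht => by
    have := hasSum_integral_rescaledStep (hpos t ht)
      (integrableOn_rescaledStep hα hβ hC₀ hl (hpos t ht))
    rwa [hroot t ht, ← Real.rpow_mul ht.le] at this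
  refine ⟨fun t ht => ?_, integrableOn_exp_neg_mul_rpow_mul_rpow hβ hC₀ (by linarith), ?_⟩
  · exact (summable_mul_left_iff (Real.rpow_pos_of_pos ht _).ne').1 (hsum t ht).summable
  obtain ⟨G, hG, hb⟩ := exists_integrableOn_bound_rescaledStep hα hβ hC₀ hl zero_lt_one
  have hlim : Tendsto (fun h => ∫ s in Set.Ioi (0 : ℝ), rescaledStep l α (2 / m) h s) (𝓝[>] 0)
      (𝓝 (∫ s in Set.Ioi (0 : ℝ), Real.exp (-C₀ * s ^ ((2 : ℝ) / m)) * s ^ (-α))) := by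
    refine tendsto_integral_filter_of_dominated_convergence G
      (Eventually.of_forall fun h => (measurable_rescaledStep l α _ h).aestronglyMeasurable)
      ?_ hG ?_
    · filter_upwards [Ioc_mem_nhdsGT zero_lt_one] with h hh
      filter_upwards [ae_restrict_mem measurableSet_Ioi] with s hs using hb h hh.1 hh.2 s hs
    · filter_upwards [ae_restrict_mem measurableSet_Ioi] with s hs using
        tendsto_rescaledStep hl hs
  have ht0 : Tendsto (fun t : ℝ => t ^ ((m : ℝ) / 2)) (𝓝[>] 0) (𝓝[>] 0) := by
    refine tendsto_nhdsWithin_iff.2 ⟨?_, ?_⟩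
    · have := (Real.continuousAt_rpow_const 0 ((m : ℝ) / 2) (Or.inr (by positivity))).tendsto
      rw [Real.zero_rpow (by positivity)] at this
      exact this.mono_left nhdsWithin_le_nhds
    · filter_upwards [self_mem_nhdsWithin] with t ht using hpos t ht
  refine (Tendsto.limsup_eq ((continuous_coe_real_ereal.tendsto _).comp
    ((hlim.comp ht0).congr' ?_))).le
  filter_upwards [self_mem_nhdsWithin] with t ht
  rw [← tsum_mul_left]
  exact (hsum t ht).tsum_eq.symm
end

section
/- Let m be a positive integer, C₀ > 0 a real number, and (λ_i)_{i≥1} a sequence of real numbers such that λ_i/i^{2/m} converges to C₀ as i → ∞. Then for every t > 0 the series ω(t) = Σ_{i=1}^{∞} e^{−λ_i t}·i^{−1} converges, and limsup_{t→0⁺} ω(t)/ln(1/t) < ∞. -/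
open Filter Topology

/-- A sequence asymptotically comparable to `i ^ a` is bounded below by a multiple of it, up to an
additive constant. -/
lemma exists_lower_bound_of_tendsto_div_rpow {a C : ℝ} (hC : 0 < C) {l : ℕ → ℝ}
    (hl : Tendsto (fun i : ℕ => l i / (i : ℝ) ^ a) atTop (𝓝 C)) :
    ∃ B : ℝ, 0 ≤ B ∧ ∀ i : ℕ, C / 2 * ((i : ℝ) + 1) ^ a - B ≤ l (i + 1) := by
  obtain ⟨N, hN⟩ := eventually_atTop.1 (hl.eventually_const_lt (half_lt_self hC))
  refine ⟨∑ j ∈ Finset.range N, |C / 2 * ((j : ℝ) + 1) ^ a - l (j + 1)|,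
    Finset.sum_nonneg fun _ _ => abs_nonneg _, fun i => ?_⟩
  by_cases hi : i < N
  · have h := Finset.single_le_sum
      (f := fun j : ℕ => |C / 2 * ((j : ℝ) + 1) ^ a - l (j + 1)|)
      (fun _ _ => abs_nonneg _) (Finset.mem_range.2 hi)
    have h' := le_abs_self (C / 2 * ((i : ℝ) + 1) ^ a - l (i + 1))
    linarith
  · have h := hN (i + 1) (by omega)
    push_cast at h
    rw [lt_div_iff₀ (by positivity)] at h
    have : 0 ≤ ∑ j ∈ Finset.range N, |C / 2 * ((j : ℝ) + 1) ^ a - l (j + 1)| :=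
      Finset.sum_nonneg fun _ _ => abs_nonneg _
    linarith

lemma exp_neg_le_rpow_neg {x s : ℝ} (hx : 0 < x) (hs : 0 ≤ s) (hs1 : s ≤ 1) :
    Real.exp (-x) ≤ x ^ (-s) := by
  rw [Real.rpow_def_of_pos hx, Real.exp_le_exp]
  have h := Real.log_le_sub_one_of_pos hx
  rcases le_total (Real.log x) 0 with h0 | h0 <;> nlinarith

lemma exp_neg_mul_inv_le {a c B t s x y : ℝ} (hc : 0 < c) (ht : 0 < t) (hs : 0 ≤ s)
    (hs1 : s ≤ 1) (hx : 0 < x) (hy : c * x ^ a - B ≤ y) :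
    Real.exp (-y * t) * x⁻¹ ≤ Real.exp (B * t) * (c * t) ^ (-s) * (1 / x ^ (1 + a * s)) := by
  have hxa : 0 < x ^ a := Real.rpow_pos_of_pos hx a
  have h1 : Real.exp (-y * t) ≤ Real.exp (B * t) * Real.exp (-(c * t * x ^ a)) := by
    rw [← Real.exp_add, Real.exp_le_exp]
    nlinarith
  have h2 := exp_neg_le_rpow_neg (x := c * t * x ^ a) (by positivity) hs hs1
  rw [Real.mul_rpow (by positivity) hxa.le, ← Real.rpow_mul hx.le] at h2
  have h3 : 1 / x ^ (1 + a * s) = x ^ (a * -s) * x⁻¹ := by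
    rw [Real.rpow_add hx, Real.rpow_one, mul_neg, Real.rpow_neg hx.le, one_div, mul_inv, mul_comm]
  rw [h3]
  calc Real.exp (-y * t) * x⁻¹
      ≤ Real.exp (B * t) * ((c * t) ^ (-s) * x ^ (a * -s)) * x⁻¹ := by
        gcongr
        exact h1.trans (by gcongr)
    _ = _ := by ring

lemma summable_one_div_add_one_rpow {p : ℝ} (hp : 1 < p) :
    Summable (fun i : ℕ => 1 / ((i : ℝ) + 1) ^ p) := by
  simpa using (summable_nat_add_iff 1).2 (Real.summable_one_div_nat_rpow.2 hp)

lemma tsum_one_div_add_one_rpow {p : ℝ} (hp : 1 < p) :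
    ∑' i : ℕ, 1 / ((i : ℝ) + 1) ^ p = ∑' n : ℕ, 1 / (n : ℝ) ^ p := by
  rw [(Real.summable_one_div_nat_rpow.2 hp).tsum_eq_zero_add]
  simp [Real.zero_rpow (by linarith : p ≠ 0)]

/-- If λ_i/i^{2/m} → C₀ > 0, then for every t > 0 the series
ω(t) = Σ_{i=1}^∞ e^{−λ_i t}·i^{−1} converges, and limsup_{t→0⁺} ω(t)/ln(1/t) < ∞. -/
theorem stmt_15 (m : ℕ) (hm : 0 < m) (C₀ : ℝ) (hC₀ : 0 < C₀)
    (l : ℕ → ℝ)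
    (hl : Tendsto (fun i : ℕ => l i / (i : ℝ) ^ ((2 : ℝ) / m)) atTop (𝓝 C₀)) :
    (∀ t : ℝ, 0 < t →
      Summable (fun i : ℕ => Real.exp (-(l (i + 1)) * t) * ((i : ℝ) + 1)⁻¹)) ∧
    Filter.limsup
      (fun t : ℝ =>
        (((∑' i : ℕ, Real.exp (-(l (i + 1)) * t) * ((i : ℝ) + 1)⁻¹)
          / Real.log (1 / t) : ℝ) : EReal))
      (𝓝[>] (0 : ℝ)) < (⊤ : EReal) := by
  have ha : (0 : ℝ) < 2 / m := by positivity
  obtain ⟨B, hB, hlB⟩ := exists_lower_bound_of_tendsto_div_rpow hC₀ hl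
  generalize (2 : ℝ) / m = a at ha hlB
  have hc : 0 < C₀ / 2 := half_pos hC₀
  generalize C₀ / 2 = c at hc hlB
  have key (t s : ℝ) (ht : 0 < t) (hs : 0 ≤ s) (hs1 : s ≤ 1) (i : ℕ) :=
    exp_neg_mul_inv_le hc ht hs hs1 (by positivity : (0 : ℝ) < i + 1) (hlB i)
  have hsum (t : ℝ) (ht : 0 < t) :
      Summable (fun i : ℕ => Real.exp (-(l (i + 1)) * t) * ((i : ℝ) + 1)⁻¹) :=
    Summable.of_nonneg_of_le (fun i => by positivity)
      (key t 1 ht zero_le_one le_rfl)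
      ((summable_one_div_add_one_rpow (by linarith)).mul_left _)
  refine ⟨hsum, ?_⟩
  have hL : Tendsto (fun t : ℝ => Real.log (1 / t)) (𝓝[>] 0) atTop := by
    simpa only [one_div, Function.comp_def] using Real.tendsto_log_atTop.comp tendsto_inv_nhdsGT_zero
  have hp : Tendsto (fun t : ℝ => 1 + a * (Real.log (1 / t))⁻¹) (𝓝[>] 0) (𝓝[>] 1) := by
    refine tendsto_nhdsWithin_iff.2 ⟨?_, ?_⟩
    · simpa using (hL.inv_tendsto_atTop.const_mul a).const_add 1
    · filter_upwards [hL.eventually_gt_atTop 0] with t ht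
      simpa using mul_pos ha (inv_pos.2 ht)
  have hZ := (tendsto_sub_mul_tsum_nat_rpow.comp hp).eventually_lt_const one_lt_two
  refine (limsup_le_of_le (a := ((Real.exp B * Real.exp (1 + |Real.log c|) * (2 / a) : ℝ) : EReal))
    (by isBoundedDefault) ?_).trans_lt (EReal.coe_lt_top _)
  filter_upwards [hZ, hL.eventually_ge_atTop 1, self_mem_nhdsWithin,
    Ioo_mem_nhdsGT (zero_lt_one' ℝ)] with t hZt hLt ht ht1
  replace ht : 0 < t := ht
  rw [EReal.coe_le_coe_iff]
  have hlog : Real.log t = -Real.log (1 / t) := by simp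
  set L := Real.log (1 / t)
  have hL0 : 0 < L := by linarith
  have hp1 : 1 < 1 + a * L⁻¹ := by
    have := mul_pos ha (inv_pos.2 hL0)
    linarith
  have hs1 : L⁻¹ ≤ 1 := inv_le_one_of_one_le₀ hLt
  have hω := (hsum t ht).tsum_le_tsum (key t L⁻¹ ht (by positivity) hs1)
    ((summable_one_div_add_one_rpow hp1).mul_left _)
  rw [tsum_mul_left, tsum_one_div_add_one_rpow hp1] at hω
  have hZ' : ∑' n : ℕ, 1 / (n : ℝ) ^ (1 + a * L⁻¹) ≤ 2 / a * L := by
    simp only [Function.comp_apply, add_sub_cancel_left] at hZt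
    have : 2 / a * L = 2 / (a * L⁻¹) := by field_simp
    rw [this, le_div_iff₀ (by positivity), mul_comm]
    exact hZt.le
  have hct : (c * t) ^ (-L⁻¹) ≤ Real.exp (1 + |Real.log c|) := by
    rw [Real.rpow_def_of_pos (by positivity), Real.exp_le_exp, Real.log_mul hc.ne' ht.ne', hlog]
    have h1 : (Real.log c + -L) * -L⁻¹ = 1 + -Real.log c * L⁻¹ := by field_simp; ring
    have h2 : -Real.log c * L⁻¹ ≤ |Real.log c| * 1 := by
      gcongr
      exact neg_le_abs _
    linarith
  have hBt : Real.exp (B * t) ≤ Real.exp B :=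
    Real.exp_le_exp.2 (mul_le_of_le_one_right hB ht1.2.le)
  rw [div_le_iff₀ hL0]
  refine hω.trans ?_
  rw [mul_assoc _ (2 / a) L]
  gcongr
end

section
/- Let m be a positive integer, C₀ > 0 a real number, and (λ_i)_{i≥1} a sequence of real numbers such that λ_i/i^{2/m} converges to C₀ as i → ∞. Then limsup_{t→0⁺} Σ_{i ≥ t^{−m/2}} e^{−λ_i t}·i^{−1} ≤ ∫₁^{∞} e^{−C₀ s^{2/m}}·s^{−1} ds, where the sum is over all integers i ≥ 1 with i·t^{m/2} ≥ 1, and the integral on the right-hand side is finite. -/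
open Filter Topology MeasureTheory

theorem integrableOn_exp_neg_mul_rpow_mul_inv {C p : ℝ} (hC : 0 < C) (hp : 0 < p) :
    IntegrableOn (fun s : ℝ => Real.exp (-C * s ^ p) * s⁻¹) (Set.Ioi 1) := by
  have h : IntegrableOn (fun s : ℝ => C⁻¹ * s ^ (-p - 1)) (Set.Ioi 1) :=
    (integrableOn_Ioi_rpow_of_lt (by linarith) one_pos).const_mul _
  refine Integrable.mono' h (by fun_prop) ?_
  filter_upwards [ae_restrict_mem measurableSet_Ioi] with s hs
  have hs0 : (0 : ℝ) < s := one_pos.trans hs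
  have hsp : 0 < s ^ p := Real.rpow_pos_of_pos hs0 p
  rw [Real.norm_of_nonneg (by positivity), Real.rpow_sub_one hs0.ne', Real.rpow_neg hs0.le,
    div_eq_mul_inv, ← mul_assoc, ← mul_inv, neg_mul, Real.exp_neg]
  gcongr
  linarith [Real.add_one_le_exp (C * s ^ p)]

theorem antitoneOn_exp_neg_mul_rpow_mul_inv {C p : ℝ} (hC : 0 < C) (hp : 0 < p) :
    AntitoneOn (fun s : ℝ => Real.exp (-C * s ^ p) * s⁻¹) (Set.Ioi 0) := by
  intro a ha b hb hab
  have ha0 : (0 : ℝ) < a := ha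
  have hb0 : (0 : ℝ) ≤ b⁻¹ := inv_nonneg.2 (le_of_lt hb)
  have h : a ^ p ≤ b ^ p := Real.rpow_le_rpow ha0.le hab hp.le
  exact mul_le_mul (Real.exp_le_exp.2 (by nlinarith)) (inv_anti₀ ha0 hab) hb0 (Real.exp_pos _).le

theorem tendsto_integral_exp_neg_mul_rpow_mul_inv {C p : ℝ} (hC : 0 < C) (hp : 0 < p) :
    Tendsto (fun c : ℝ => ∫ s in Set.Ioi (1 : ℝ), Real.exp (-c * s ^ p) * s⁻¹) (𝓝 C)
      (𝓝 (∫ s in Set.Ioi (1 : ℝ), Real.exp (-C * s ^ p) * s⁻¹)) := by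
  refine tendsto_integral_filter_of_dominated_convergence
    (fun s : ℝ => Real.exp (-(C / 2) * s ^ p) * s⁻¹) (.of_forall fun c => by fun_prop) ?_
    (integrableOn_exp_neg_mul_rpow_mul_inv (half_pos hC) hp) (.of_forall fun s => ?_)
  · filter_upwards [lt_mem_nhds (half_lt_self hC)] with c hc
    filter_upwards [ae_restrict_mem measurableSet_Ioi] with s hs
    have hs0 : (0 : ℝ) < s := one_pos.trans hs
    rw [Real.norm_of_nonneg (by positivity)]
    gcongr
  · exact Continuous.tendsto (f := fun c : ℝ => Real.exp (-c * s ^ p) * s⁻¹) (by fun_prop) C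

/-- Comparison of a scaled tail sum of an antitone function with its integral over `(1, ∞)`. -/
theorem sum_range_scaled_tail_le_integral {f : ℝ → ℝ} (hanti : AntitoneOn f (Set.Ioi 0))
    (hnonneg : ∀ x, 0 < x → 0 ≤ f x) (hint : IntegrableOn f (Set.Ioi 1)) {d : ℝ} (hd : 0 < d)
    (n : ℕ) :
    ∑ i ∈ Finset.range n, (if 1 ≤ (i : ℝ) * d then f (i * d) * d else 0) ≤
      f 1 * d + ∫ s in Set.Ioi (1 : ℝ), f s := by
  set k : ℕ := ⌈d⁻¹⌉₊ with hk
  set g : ℕ → ℝ := fun i => if 1 ≤ (i : ℝ) * d then f (i * d) * d else 0 with hg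
  have hcond (i : ℕ) : 1 ≤ (i : ℝ) * d ↔ k ≤ i := by
    rw [hk, Nat.ceil_le, inv_le_iff_one_le_mul₀ hd]
  have hkd : 1 ≤ (k : ℝ) * d := (hcond k).2 le_rfl
  have hk0 : (0 : ℝ) < k := by
    by_contra h
    nlinarith
  have hg0 (i : ℕ) : 0 ≤ g i := by
    simp only [hg]
    split_ifs with h
    · exact mul_nonneg (hnonneg _ (one_pos.trans_le h)) hd.le
    · exact le_rfl
  have hzero : ∑ i ∈ Finset.range k, g i = 0 := by
    refine Finset.sum_eq_zero fun i hi => ?_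
    simp only [hg]
    rw [if_neg]
    rw [hcond]
    exact not_le.2 (Finset.mem_range.1 hi)
  have hfirst : g k ≤ f 1 * d := by
    simp only [hg]
    rw [if_pos hkd]
    gcongr
    exact hanti (Set.mem_Ioi.2 one_pos) (Set.mem_Ioi.2 (one_pos.trans_le hkd)) hkd
  have htail : ∑ j ∈ Finset.range n, g (k + 1 + j) ≤ ∫ s in Set.Ioi (1 : ℝ), f s := by
    have hanti' : AntitoneOn (fun x : ℝ => f (x * d) * d) (Set.Icc (k : ℝ) (k + n)) := by
      intro a ha b hb hab
      have ha0 : 0 < a := hk0.trans_le ha.1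
      dsimp only
      gcongr
      exact hanti (Set.mem_Ioi.2 (by positivity))
        (Set.mem_Ioi.2 (mul_pos (ha0.trans_le hab) hd)) (by gcongr)
    calc ∑ j ∈ Finset.range n, g (k + 1 + j)
        = ∑ j ∈ Finset.range n, f ((k + (j + 1 : ℕ)) * d) * d := by
          refine Finset.sum_congr rfl fun j _ => ?_
          simp only [hg]
          rw [if_pos ((hcond _).2 (by omega))]
          push_cast
          ring_nf
      _ ≤ ∫ x in (k : ℝ)..(k + n), f (x * d) * d := hanti'.sum_le_integral
      _ = ∫ x in (k * d : ℝ)..((k + n) * d), f x := by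
          rw [intervalIntegral.integral_mul_const, intervalIntegral.integral_comp_mul_right _ hd.ne',
            smul_eq_mul]
          field_simp
      _ ≤ ∫ s in Set.Ioi (1 : ℝ), f s := by
          rw [intervalIntegral.integral_of_le (by gcongr; simp)]
          refine setIntegral_mono_set hint ?_ ?_
          · filter_upwards [ae_restrict_mem measurableSet_Ioi] with s hs
            exact hnonneg s (one_pos.trans hs)
          · exact (Set.Ioc_subset_Ioi_self.trans (Set.Ioi_subset_Ioi hkd)).eventuallyLE
  calc ∑ i ∈ Finset.range n, g i
      ≤ ∑ i ∈ Finset.range (k + 1 + n), g i :=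
        Finset.sum_le_sum_of_subset_of_nonneg (Finset.range_mono (by omega)) fun i _ _ => hg0 i
    _ ≤ f 1 * d + ∫ s in Set.Ioi (1 : ℝ), f s := by
        rw [Finset.sum_range_add, Finset.sum_range_succ, hzero, zero_add]
        exact add_le_add hfirst htail

/-- If λ_i/i^{2/m} → C₀ > 0, then
limsup_{t→0⁺} Σ_{i·t^{m/2} ≥ 1} e^{−λ_i t}·i^{−1} ≤ ∫₁^∞ e^{−C₀ s^{2/m}}·s^{−1} ds,
this integral being finite. -/
theorem stmt_16 (m : ℕ) (hm : 0 < m) (C₀ : ℝ) (hC₀ : 0 < C₀)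
    (l : ℕ → ℝ)
    (hl : Tendsto (fun i : ℕ => l i / (i : ℝ) ^ ((2 : ℝ) / m)) atTop (𝓝 C₀)) :
    IntegrableOn (fun s : ℝ => Real.exp (-C₀ * s ^ ((2 : ℝ) / m)) * s⁻¹)
      (Set.Ioi 1) ∧
    Filter.limsup
      (fun t : ℝ =>
        ((∑' i : ℕ, if 1 ≤ (i : ℝ) * t ^ ((m : ℝ) / 2)
            then Real.exp (-(l i) * t) * (i : ℝ)⁻¹ else 0 : ℝ) : EReal))
      (𝓝[>] (0 : ℝ))
      ≤ ((∫ s in Set.Ioi (1 : ℝ),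
          Real.exp (-C₀ * s ^ ((2 : ℝ) / m)) * s⁻¹ : ℝ) : EReal) := by
  have hm0 : (0 : ℝ) < m := by exact_mod_cast hm
  have hp : (0 : ℝ) < 2 / m := by positivity
  refine ⟨integrableOn_exp_neg_mul_rpow_mul_inv hC₀ hp, ?_⟩
  refine EReal.le_of_forall_lt_iff_le.1 fun z hz => ?_
  replace hz := EReal.coe_lt_coe_iff.1 hz
  obtain ⟨C, hCz, hC0, hCC⟩ : ∃ C : ℝ,
      (∫ s in Set.Ioi (1 : ℝ), Real.exp (-C * s ^ ((2 : ℝ) / m)) * s⁻¹) < z ∧ 0 < C ∧ C < C₀ := by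
    have h1 := (tendsto_integral_exp_neg_mul_rpow_mul_inv hC₀ hp).eventually (gt_mem_nhds hz)
    have h2 : ∀ᶠ c in 𝓝 C₀, 0 < c := lt_mem_nhds hC₀
    have h3 : ∀ᶠ c in 𝓝[<] C₀, c < C₀ := self_mem_nhdsWithin
    obtain ⟨C, h, h'⟩ := (((h1.and h2).filter_mono nhdsWithin_le_nhds).and h3).exists
    exact ⟨C, h.1, h.2, h'⟩
  set f : ℝ → ℝ := fun s => Real.exp (-C * s ^ ((2 : ℝ) / m)) * s⁻¹ with hf
  obtain ⟨N, hN⟩ := eventually_atTop.1 (hl.eventually (lt_mem_nhds hCC))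
  have hd_lim : Tendsto (fun t : ℝ => t ^ ((m : ℝ) / 2)) (𝓝[>] 0) (𝓝 0) := by
    have h := (Real.continuousAt_rpow_const 0 ((m : ℝ) / 2) (Or.inr (by positivity))).tendsto
    rw [Real.zero_rpow (by positivity)] at h
    exact h.mono_left nhdsWithin_le_nhds
  have h1 : ∀ᶠ t : ℝ in 𝓝[>] 0, f 1 * t ^ ((m : ℝ) / 2) + ∫ s in Set.Ioi (1 : ℝ), f s < z := by
    have h := (hd_lim.const_mul (f 1)).add_const (∫ s in Set.Ioi (1 : ℝ), f s)
    rw [mul_zero, zero_add] at h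
    exact h.eventually (gt_mem_nhds hCz)
  have h2 : ∀ᶠ t : ℝ in 𝓝[>] 0, t ^ ((m : ℝ) / 2) * N < 1 := by
    have h := hd_lim.mul_const (N : ℝ)
    rw [zero_mul] at h
    exact h.eventually (gt_mem_nhds one_pos)
  refine limsup_le_of_le (by isBoundedDefault) ?_
  filter_upwards [h1, h2, self_mem_nhdsWithin] with t ht1 ht2 ht
  have ht0 : (0 : ℝ) < t := ht
  rw [EReal.coe_le_coe_iff]
  set d : ℝ := t ^ ((m : ℝ) / 2) with hd
  have hd0 : 0 < d := Real.rpow_pos_of_pos ht0 _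
  have hdt : d ^ ((2 : ℝ) / m) = t := by
    rw [hd, ← Real.rpow_mul ht0.le, show (m : ℝ) / 2 * (2 / m) = 1 by field_simp, Real.rpow_one]
  refine Real.tsum_le_of_sum_range_le (fun i => by split_ifs <;> positivity) fun n => ?_
  refine le_trans (Finset.sum_le_sum fun i _ => ?_)
    ((sum_range_scaled_tail_le_integral (antitoneOn_exp_neg_mul_rpow_mul_inv hC0 hp)
      (fun x hx => by positivity) (integrableOn_exp_neg_mul_rpow_mul_inv hC0 hp) hd0 n).trans
      ht1.le)
  split_ifs with hi
  · have hi0 : (0 : ℝ) < i := pos_of_mul_pos_left (one_pos.trans_le hi) hd0.le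
    have hNi : N ≤ i := by
      by_contra! h
      have : (i : ℝ) ≤ N := by exact_mod_cast h.le
      nlinarith
    have hli := (lt_div_iff₀ (Real.rpow_pos_of_pos hi0 _)).1 (hN i hNi)
    have hinv : ((i : ℝ) * d)⁻¹ * d = (i : ℝ)⁻¹ := by field_simp
    rw [mul_assoc (Real.exp _), hinv, Real.mul_rpow hi0.le hd0.le, hdt]
    gcongr ?_ * _
    exact Real.exp_le_exp.2 (by nlinarith)
  · exact le_rfl
end

section
/- Let m be a positive integer and α a real number. For j = 1, 2, let (λ_i^{(j)})_{i≥1} be a sequence of nonnegative real numbers, and let (a_i^{(j)})_{i≥0} be a sequence of real numbers, such that: (i) for every nonnegative integer N, Σ_{i=1}^{∞} e^{−λ_i^{(j)} t} − (4πt)^{−m/2}·Σ_{i=0}^{N} a_i^{(j)} t^i = O(t^{N − m/2 + 1}) as t → 0⁺; (ii) there exist real numbers C > 0, K > 0 and V₁, V₂ > 0 such that λ_i^{(j)}/i^{2/m} converges to C·V_j^{−2/m} as i → ∞ and a_0^{(j)} = K·V_j for j = 1, 2; (iii) limsup_{i→∞} |λ_i^{(1)} − λ_i^{(2)}|·i^{α}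 < ∞. Then a_i^{(1)} = a_i^{(2)} for every nonnegative integer i with i < 1 + (m/2)·min(α, 1). -/
open Filter Topology Asymptotics Real

theorem rpow_isLittleO_rpow_nhdsGT_zero {r s : ℝ} (h : s < r) :
    (fun t : ℝ => t ^ r) =o[𝓝[>] (0 : ℝ)] fun t : ℝ => t ^ s := by
  rw [isLittleO_iff_tendsto']
  · have h0 : Tendsto (fun t : ℝ => t ^ (r - s)) (𝓝[>] 0) (𝓝 0) := by
      have := (continuousAt_rpow_const (0 : ℝ) (r - s) (Or.inr (sub_pos.2 h).le)).tendsto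
      rw [zero_rpow (sub_pos.2 h).ne'] at this
      exact this.mono_left nhdsWithin_le_nhds
    refine h0.congr' ?_
    filter_upwards [self_mem_nhdsWithin] with t ht
    exact rpow_sub ht r s
  · filter_upwards [self_mem_nhdsWithin] with t ht h0
    exact absurd h0 (rpow_pos_of_pos ht s).ne'

/-- Comparison of `∑ i ^ (-β) * exp (-b * i ^ p)` with the corresponding Gamma integral. -/
theorem sum_range_rpow_mul_exp_le {β p b : ℝ} (hβ0 : 0 ≤ β) (hβ1 : β < 1) (hp : 0 < p)
    (hb : 0 < b) (n : ℕ) :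
    ∑ i ∈ Finset.range n, ((i + 1 : ℕ) : ℝ) ^ (-β) * exp (-b * ((i + 1 : ℕ) : ℝ) ^ p) ≤
      b ^ (-(1 - β) / p) * (1 / p) * Gamma ((1 - β) / p) := by
  set f : ℝ → ℝ := fun x => x ^ (-β) * exp (-b * x ^ p) with hf
  have hint : MeasureTheory.IntegrableOn f (Set.Ioi 0) :=
    integrableOn_rpow_mul_exp_neg_mul_rpow (by linarith) hp hb
  have hsub : ∀ x y : ℝ, 0 ≤ x → Set.Ioc x y ⊆ Set.Ioi 0 := fun x y hx z hz => hx.trans_lt hz.1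
  have hii : ∀ k : ℕ, IntervalIntegrable f MeasureTheory.volume (k : ℝ) ((k + 1 : ℕ) : ℝ) := by
    intro k
    rw [intervalIntegrable_iff_integrableOn_Ioc_of_le (by push_cast; linarith)]
    exact hint.mono_set (hsub _ _ k.cast_nonneg)
  have hterm : ∀ k : ℕ, f ((k + 1 : ℕ) : ℝ) ≤ ∫ x in (k : ℝ)..((k + 1 : ℕ) : ℝ), f x := by
    intro k
    have hc : ∫ _ in (k : ℝ)..((k + 1 : ℕ) : ℝ), f ((k + 1 : ℕ) : ℝ) = f ((k + 1 : ℕ) : ℝ) := by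
      simp
    rw [← hc]
    refine intervalIntegral.integral_mono_on_of_le_Ioo (by push_cast; linarith)
      intervalIntegrable_const (hii k) fun x hx => ?_
    have hx0 : 0 < x := lt_of_le_of_lt k.cast_nonneg hx.1
    have h1 : ((k + 1 : ℕ) : ℝ) ^ (-β) ≤ x ^ (-β) :=
      rpow_le_rpow_of_nonpos hx0 hx.2.le (by linarith)
    have h2 : x ^ p ≤ ((k + 1 : ℕ) : ℝ) ^ p := rpow_le_rpow hx0.le hx.2.le hp.le
    have h3 : -b * ((k + 1 : ℕ) : ℝ) ^ p ≤ -b * x ^ p := by nlinarith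
    exact mul_le_mul h1 (exp_le_exp.2 h3) (exp_pos _).le (rpow_nonneg hx0.le _)
  calc ∑ i ∈ Finset.range n, f ((i + 1 : ℕ) : ℝ)
      ≤ ∑ i ∈ Finset.range n, ∫ x in (i : ℝ)..((i + 1 : ℕ) : ℝ), f x :=
        Finset.sum_le_sum fun i _ => hterm i
    _ = ∫ x in ((0 : ℕ) : ℝ)..(n : ℝ), f x :=
        intervalIntegral.sum_integral_adjacent_intervals (a := fun k : ℕ => (k : ℝ))
          fun k _ => hii k
    _ = ∫ x in Set.Ioc (0 : ℝ) n, f x := by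
        rw [intervalIntegral.integral_of_le (by simp), Nat.cast_zero]
    _ ≤ ∫ x in Set.Ioi (0 : ℝ), f x := by
        refine MeasureTheory.setIntegral_mono_set hint ?_ (hsub 0 n le_rfl).eventuallyLE
        filter_upwards [MeasureTheory.ae_restrict_mem measurableSet_Ioi] with x hx
        exact mul_nonneg (rpow_nonneg (le_of_lt hx) _) (exp_pos _).le
    _ = _ := by
        rw [hf, integral_rpow_mul_exp_neg_mul_rpow hp (by linarith) hb]
        ring_nf

theorem summable_rpow_mul_exp {β p b : ℝ} (hβ0 : 0 ≤ β) (hβ1 : β < 1) (hp : 0 < p) (hb : 0 < b) :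
    Summable fun i : ℕ => ((i + 1 : ℕ) : ℝ) ^ (-β) * exp (-b * ((i + 1 : ℕ) : ℝ) ^ p) :=
  summable_of_sum_range_le (fun _ => by positivity) (sum_range_rpow_mul_exp_le hβ0 hβ1 hp hb)

theorem tsum_rpow_mul_exp_le {β p b : ℝ} (hβ0 : 0 ≤ β) (hβ1 : β < 1) (hp : 0 < p) (hb : 0 < b) :
    ∑' i : ℕ, ((i + 1 : ℕ) : ℝ) ^ (-β) * exp (-b * ((i + 1 : ℕ) : ℝ) ^ p) ≤
      b ^ (-(1 - β) / p) * (1 / p) * Gamma ((1 - β) / p) :=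
  Real.tsum_le_of_sum_range_le (fun _ => by positivity) (sum_range_rpow_mul_exp_le hβ0 hβ1 hp hb)

theorem exp_sub_exp_le {x y z : ℝ} (hx : x ≤ z) : exp x - exp y ≤ |x - y| * exp z := by
  have h1 : exp x * (1 - (x - y)) ≤ exp y := by
    have := add_one_le_exp (y - x)
    have h2 : exp y = exp x * exp (y - x) := by rw [← exp_add]; ring_nf
    rw [h2]
    exact mul_le_mul_of_nonneg_left (by linarith) (exp_pos x).le
  have h3 : (x - y) * exp x ≤ |x - y| * exp z :=
    mul_le_mul (le_abs_self _) (exp_le_exp.2 hx) (exp_pos _).le (abs_nonneg _)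
  linarith

theorem abs_exp_sub_exp_le {x y z : ℝ} (hx : x ≤ z) (hy : y ≤ z) :
    |exp x - exp y| ≤ |x - y| * exp z := by
  refine abs_sub_le_iff.2 ⟨exp_sub_exp_le hx, ?_⟩
  rw [abs_sub_comm]
  exact exp_sub_exp_le hy

/-- A sequence growing like `i ^ p` has a convergent heat trace. -/
theorem summable_exp_neg_mul {p c E t : ℝ} (hp : 0 < p) (hc : 0 < c) (ht : 0 < t) {u : ℕ → ℝ}
    (hu : ∀ i : ℕ, c * ((i + 1 : ℕ) : ℝ) ^ p - E ≤ u i) :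
    Summable fun i => exp (-(u i) * t) := by
  refine Summable.of_nonneg_of_le (fun i => (exp_pos _).le) (fun i => ?_)
    ((summable_rpow_mul_exp le_rfl one_pos hp (mul_pos hc ht)).mul_left (exp (E * t)))
  rw [neg_zero, rpow_zero, one_mul, ← exp_add]
  refine exp_le_exp.2 ?_
  nlinarith [mul_le_mul_of_nonneg_right (hu i) ht.le]

/-- Closeness of two spectra of polynomial growth bounds the difference of their heat traces. -/
theorem tsum_exp_sub_tsum_exp_isBigO {β p c E D : ℝ} (hβ0 : 0 ≤ β) (hβ1 : β < 1) (hp : 0 < p)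
    (hc : 0 < c) {u v : ℕ → ℝ}
    (hu : ∀ i : ℕ, c * ((i + 1 : ℕ) : ℝ) ^ p - E ≤ u i)
    (hv : ∀ i : ℕ, c * ((i + 1 : ℕ) : ℝ) ^ p - E ≤ v i)
    (huv : ∀ i : ℕ, |u i - v i| ≤ D * ((i + 1 : ℕ) : ℝ) ^ (-β)) :
    (fun t : ℝ => (∑' i, exp (-(u i) * t)) - ∑' i, exp (-(v i) * t))
      =O[𝓝[>] (0 : ℝ)] fun t : ℝ => t ^ (1 - (1 - β) / p) := by
  have hD : 0 ≤ D := by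
    have := (abs_nonneg _).trans (huv 0)
    simpa using this
  refine IsBigO.of_bound
    (D * exp |E| * (c ^ (-(1 - β) / p) * (1 / p) * Gamma ((1 - β) / p))) ?_
  filter_upwards [Ioo_mem_nhdsGT (zero_lt_one' ℝ)] with t ht
  obtain ⟨ht0, ht1⟩ := ht
  have hct := mul_pos hc ht0
  have hsu := summable_exp_neg_mul hp hc ht0 hu
  have hsv := summable_exp_neg_mul hp hc ht0 hv
  have hE : E * t ≤ |E| :=
    (le_abs_self _).trans (by
      rw [abs_mul, abs_of_pos ht0]; exact mul_le_of_le_one_right (abs_nonneg E) ht1.le)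
  have hterm : ∀ i : ℕ, ‖exp (-(u i) * t) - exp (-(v i) * t)‖ ≤ t * D * exp |E| *
      (((i + 1 : ℕ) : ℝ) ^ (-β) * exp (-(c * t) * ((i + 1 : ℕ) : ℝ) ^ p)) := by
    intro i
    have hz : ∀ w : ℝ, c * ((i + 1 : ℕ) : ℝ) ^ p - E ≤ w →
        -w * t ≤ |E| + -(c * t) * ((i + 1 : ℕ) : ℝ) ^ p := fun w hw => by
      nlinarith [mul_le_mul_of_nonneg_right hw ht0.le]
    refine (abs_exp_sub_exp_le (hz _ (hu i)) (hz _ (hv i))).trans ?_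
    have h1 : |-(u i) * t - -(v i) * t| = t * |u i - v i| := by
      rw [show -(u i) * t - -(v i) * t = -(t * (u i - v i)) by ring, abs_neg, abs_mul,
        abs_of_pos ht0]
    rw [h1, exp_add]
    calc t * |u i - v i| * (exp |E| * exp (-(c * t) * ((i + 1 : ℕ) : ℝ) ^ p))
        ≤ t * (D * ((i + 1 : ℕ) : ℝ) ^ (-β)) *
            (exp |E| * exp (-(c * t) * ((i + 1 : ℕ) : ℝ) ^ p)) := by
          gcongr
          exact huv i
      _ = _ := by ring
  have hsum := (summable_rpow_mul_exp hβ0 hβ1 hp hct).mul_left (t * D * exp |E|)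
  rw [← hsu.tsum_sub hsv]
  refine (tsum_of_norm_bounded hsum.hasSum hterm).trans ?_
  rw [tsum_mul_left, norm_of_nonneg (rpow_nonneg ht0.le _)]
  refine (mul_le_mul_of_nonneg_left (tsum_rpow_mul_exp_le hβ0 hβ1 hp hct)
    (by positivity)).trans_eq ?_
  rw [mul_rpow hc.le ht0.le, sub_eq_add_neg 1 ((1 - β) / p), rpow_add ht0, rpow_one, neg_div]
  ring

theorem exists_mul_rpow_sub_le {p c L : ℝ} {l : ℕ → ℝ} (hcL : c < L)
    (h : Tendsto (fun i : ℕ => l i / (i : ℝ) ^ p) atTop (𝓝 L)) :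
    ∃ E, ∀ i : ℕ, c * ((i + 1 : ℕ) : ℝ) ^ p - E ≤ l (i + 1) := by
  have hev : ∀ᶠ i : ℕ in atTop, c * (i : ℝ) ^ p - l i ≤ 0 := by
    filter_upwards [h.eventually (lt_mem_nhds hcL), eventually_gt_atTop 0] with i hi hi0
    have hpos : (0 : ℝ) < (i : ℝ) ^ p := rpow_pos_of_pos (by exact_mod_cast hi0) _
    have := (lt_div_iff₀ hpos).1 hi
    linarith
  obtain ⟨E, hE⟩ := (isBoundedUnder_of_eventually_le hev).bddAbove_range
  refine ⟨E, fun i => ?_⟩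
  have : c * ((i + 1 : ℕ) : ℝ) ^ p - l (i + 1) ≤ E := hE (Set.mem_range_self (i + 1))
  linarith

/-- If a function has two expansions up to order `n` agreeing below order `n`, and the difference
of the functions is small, then the coefficients of order `n` agree. -/
theorem heat_coeff_eq_of_isLittleO {m : ℝ} {n : ℕ} {F G : ℝ → ℝ} {a b : ℕ → ℝ}
    (hF : (fun t : ℝ => F t - (4 * π * t) ^ (-m / 2) * ∑ i ∈ Finset.range (n + 1), a i * t ^ i)
      =O[𝓝[>] (0 : ℝ)] fun t : ℝ => t ^ ((n : ℝ) - m / 2 + 1))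
    (hG : (fun t : ℝ => G t - (4 * π * t) ^ (-m / 2) * ∑ i ∈ Finset.range (n + 1), b i * t ^ i)
      =O[𝓝[>] (0 : ℝ)] fun t : ℝ => t ^ ((n : ℝ) - m / 2 + 1))
    (hFG : (fun t => F t - G t) =o[𝓝[>] (0 : ℝ)] fun t : ℝ => t ^ ((n : ℝ) - m / 2))
    (hab : ∀ i < n, a i = b i) : a n = b n := by
  have hlt : (n : ℝ) - m / 2 < (n : ℝ) - m / 2 + 1 := by linarith
  have hF' := hF.trans_isLittleO (rpow_isLittleO_rpow_nhdsGT_zero hlt)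
  have hG' := hG.trans_isLittleO (rpow_isLittleO_rpow_nhdsGT_zero hlt)
  have key : (fun t : ℝ => ((4 * π) ^ (-m / 2) * (a n - b n)) * t ^ ((n : ℝ) - m / 2))
      =o[𝓝[>] (0 : ℝ)] fun t : ℝ => t ^ ((n : ℝ) - m / 2) := by
    refine ((hFG.sub hF').add hG').congr' ?_ EventuallyEq.rfl
    filter_upwards [self_mem_nhdsWithin] with t ht
    have ht : 0 < t := ht
    have hs : ∑ i ∈ Finset.range n, a i * t ^ i = ∑ i ∈ Finset.range n, b i * t ^ i :=
      Finset.sum_congr rfl fun i hi => by rw [hab i (Finset.mem_range.1 hi)]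
    rw [Finset.sum_range_succ, Finset.sum_range_succ, hs, mul_rpow (by positivity) ht.le,
      sub_eq_add_neg (n : ℝ) (m / 2), rpow_add ht, rpow_natCast, neg_div]
    ring
  have h4 : (4 * π) ^ (-m / 2) ≠ 0 := (rpow_pos_of_pos (by positivity) _).ne'
  by_contra hne
  have hk : (4 * π) ^ (-m / 2) * (a n - b n) ≠ 0 := mul_ne_zero h4 (sub_ne_zero.2 hne)
  refine isLittleO_irrefl ?_ ((isLittleO_const_mul_left_iff hk).1 key)
  refine Eventually.frequently ?_
  filter_upwards [self_mem_nhdsWithin] with t ht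
  exact (rpow_pos_of_pos ht _).ne'

/-- Suppose that for j = 1, 2 the nonnegative sequences (λ_i^{(j)})_{i≥1}
and the coefficient sequences (a_i^{(j)})_{i≥0} satisfy the heat-trace asymptotic
expansion Σ_{i=1}^∞ e^{−λ_i^{(j)} t} − (4πt)^{−m/2}·Σ_{i=0}^N a_i^{(j)} t^i
= O(t^{N−m/2+1}) as t → 0⁺ for each N ≥ 0, Weyl's law
λ_i^{(j)}/i^{2/m} → C·V_j^{−2/m} with a_0^{(j)} = K·V_j (C, K, V₁, V₂ > 0), and the
α-isospectrality condition |λ_i^{(1)} − λ_i^{(2)}| = O(i^{−α}). Then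
a_i^{(1)} = a_i^{(2)} for every i < 1 + (m/2)·min(α, 1). -/
theorem stmt_17 (m : ℕ) (hm : 0 < m) (α : ℝ)
    (l₁ l₂ : ℕ → ℝ) (a₁ a₂ : ℕ → ℝ)
    (hl₁pos : ∀ i : ℕ, 0 ≤ l₁ i) (hl₂pos : ∀ i : ℕ, 0 ≤ l₂ i)
    (hexp₁ : ∀ N : ℕ,
      (fun t : ℝ => (∑' i : ℕ, Real.exp (-(l₁ (i + 1)) * t))
          - (4 * Real.pi * t) ^ (-(m : ℝ) / 2)
            * ∑ i ∈ Finset.range (N + 1), a₁ i * t ^ i)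
        =O[𝓝[>] (0 : ℝ)] fun t : ℝ => t ^ ((N : ℝ) - (m : ℝ) / 2 + 1))
    (hexp₂ : ∀ N : ℕ,
      (fun t : ℝ => (∑' i : ℕ, Real.exp (-(l₂ (i + 1)) * t))
          - (4 * Real.pi * t) ^ (-(m : ℝ) / 2)
            * ∑ i ∈ Finset.range (N + 1), a₂ i * t ^ i)
        =O[𝓝[>] (0 : ℝ)] fun t : ℝ => t ^ ((N : ℝ) - (m : ℝ) / 2 + 1))
    (C K V₁ V₂ : ℝ) (hC : 0 < C) (hK : 0 < K) (hV₁ : 0 < V₁) (hV₂ : 0 < V₂)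
    (hweyl₁ : Tendsto (fun i : ℕ => l₁ i / (i : ℝ) ^ ((2 : ℝ) / m)) atTop
      (𝓝 (C * V₁ ^ (-(2 : ℝ) / m))))
    (hweyl₂ : Tendsto (fun i : ℕ => l₂ i / (i : ℝ) ^ ((2 : ℝ) / m)) atTop
      (𝓝 (C * V₂ ^ (-(2 : ℝ) / m))))
    (ha₁0 : a₁ 0 = K * V₁) (ha₂0 : a₂ 0 = K * V₂)
    (hiso : (fun i : ℕ => l₁ i - l₂ i) =O[atTop] fun i : ℕ => (i : ℝ) ^ (-α)) :
    ∀ i : ℕ, (i : ℝ) < 1 + ((m : ℝ) / 2) * min α 1 → a₁ i = a₂ i := by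
  have hm' : (0 : ℝ) < m := by exact_mod_cast hm
  have hp : (0 : ℝ) < 2 / m := by positivity
  intro n
  induction n using Nat.strong_induction_on with
  | _ n ih =>
  intro hn
  rcases Nat.eq_zero_or_pos n with rfl | hn0
  · have hα : -α - 2 / m < 0 := by
      have h1 : 0 < 1 + (m : ℝ) / 2 * α := by
        have := mul_le_mul_of_nonneg_left (min_le_left α 1) (by positivity : (0 : ℝ) ≤ m / 2)
        push_cast at hn
        linarith
      have h2 : -α - 2 / m = -((2 / m) * (1 + (m : ℝ) / 2 * α)) := by field_simp; ring
      rw [h2, neg_lt_zero]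
      positivity
    have hdiff : Tendsto (fun i : ℕ => l₁ i / (i : ℝ) ^ ((2 : ℝ) / m)
        - l₂ i / (i : ℝ) ^ ((2 : ℝ) / m)) atTop (𝓝 0) := by
      have h0 : Tendsto (fun i : ℕ => (i : ℝ) ^ (-α - 2 / m)) atTop (𝓝 0) := by
        have := (tendsto_rpow_neg_atTop (neg_pos.2 hα)).comp tendsto_natCast_atTop_atTop
        simpa only [neg_neg, Function.comp_def] using this
      have hO := hiso.mul (isBigO_refl (fun i : ℕ => ((i : ℝ) ^ ((2 : ℝ) / m))⁻¹) atTop)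
      have hO' : (fun i : ℕ => l₁ i / (i : ℝ) ^ ((2 : ℝ) / m) - l₂ i / (i : ℝ) ^ ((2 : ℝ) / m))
          =O[atTop] fun i : ℕ => (i : ℝ) ^ (-α - 2 / m) := by
        refine hO.congr' (Eventually.of_forall fun i => by ring) ?_
        filter_upwards [eventually_gt_atTop 0] with i hi
        rw [rpow_sub (by exact_mod_cast hi)]
        exact (div_eq_mul_inv _ _).symm
      exact hO'.trans_tendsto h0
    have heq := tendsto_nhds_unique hdiff (hweyl₁.sub hweyl₂)
    have hV : V₁ ^ (-(2 : ℝ) / m) = V₂ ^ (-(2 : ℝ) / m) :=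
      mul_left_cancel₀ hC.ne' (by linarith)
    have hne : -(2 : ℝ) / m ≠ 0 := by
      rw [neg_div]
      exact (neg_neg_of_pos hp).ne
    rw [ha₁0, ha₂0, (rpow_left_inj hV₁.le hV₂.le hne).1 hV]
  · have hn1 : (1 : ℝ) ≤ n := by exact_mod_cast hn0
    obtain ⟨β, hβn, hβ⟩ : ∃ β, (2 / m) * ((n : ℝ) - 1) < β ∧ β < min α 1 := by
      refine exists_between ?_
      have h1 : (n : ℝ) - 1 < m / 2 * min α 1 := by linarith
      calc (2 / m) * ((n : ℝ) - 1) < (2 / m) * (m / 2 * min α 1) := by gcongr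
        _ = min α 1 := by field_simp
    obtain ⟨hβα, hβ1⟩ := lt_min_iff.1 hβ
    have hβ0 : 0 < β := lt_of_le_of_lt (mul_nonneg hp.le (by linarith)) hβn
    have hL₁ : 0 < C * V₁ ^ (-(2 : ℝ) / m) := by positivity
    have hL₂ : 0 < C * V₂ ^ (-(2 : ℝ) / m) := by positivity
    obtain ⟨c, hc0, hc⟩ := exists_between (lt_min hL₁ hL₂)
    obtain ⟨hc₁, hc₂⟩ := lt_min_iff.1 hc
    obtain ⟨E₁, hE₁⟩ := exists_mul_rpow_sub_le hc₁ hweyl₁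
    obtain ⟨E₂, hE₂⟩ := exists_mul_rpow_sub_le hc₂ hweyl₂
    obtain ⟨D, -, hD⟩ := bound_of_isBigO_nat_atTop hiso
    have hd : ∀ i : ℕ, |l₁ (i + 1) - l₂ (i + 1)| ≤ |D| * ((i + 1 : ℕ) : ℝ) ^ (-β) := by
      intro i
      have hpos : (0 : ℝ) < ((i + 1 : ℕ) : ℝ) ^ (-α) := by positivity
      have h1 := hD hpos.ne'
      rw [norm_of_nonneg hpos.le] at h1
      refine h1.trans (mul_le_mul (le_abs_self D) ?_ hpos.le (abs_nonneg D))
      exact rpow_le_rpow_of_exponent_le (by simp) (by linarith)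
    have hO := tsum_exp_sub_tsum_exp_isBigO (E := max E₁ E₂) (u := fun i => l₁ (i + 1))
      (v := fun i => l₂ (i + 1)) hβ0.le hβ1 hp hc0
      (fun i => (sub_le_sub_left (le_max_left _ _) _).trans (hE₁ i))
      (fun i => (sub_le_sub_left (le_max_right _ _) _).trans (hE₂ i)) hd
    refine heat_coeff_eq_of_isLittleO (hexp₁ n) (hexp₂ n)
      (hO.trans_isLittleO (rpow_isLittleO_rpow_nhdsGT_zero ?_)) fun i hi => ih i hi ?_
    · have h1 : (n : ℝ) - 1 < m / 2 * β := by
        calc (n : ℝ) - 1 = m / 2 * ((2 / m) * ((n : ℝ) - 1)) := by field_simp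
          _ < m / 2 * β := by gcongr
      have h2 : (1 - β) / (2 / (m : ℝ)) = m / 2 - m / 2 * β := by field_simp
      rw [h2]
      linarith
    · have : (i : ℝ) < n := by exact_mod_cast hi
      linarith
end
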